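/- Every first-order transduction f : Σ* ⇀ Γ* (a partial function computed by some deterministic two-way finite transducer whose behaviour monoid is aperiodic) can be computed by a planar reversible two-way finite transducer. -/

import Mathlib

namespace Planar2DFT

/-- Tape alphabet: input letters plus the two endmarkers `▷` and `◁`. -/
inductive Tape (A : Type) where
  | lend : Tape A
  | rend : Tape A
  | sym  : A → Tape A

/-- Edges of the transition profile `G(ρ, f)` on vertices `Q × Bool`
(`true` codes direction `+1`, `false` codes `-1`): an edge
`(q, -ρ q) → (r, ρ r)` for every `(q, r) ∈ f`. -/
def ProfileEdge {Q : Type} (ρ : Q → Bool) (f : Set (Q × Q)) :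
    Q × Bool → Q × Bool → Prop :=
  fun u v => ∃ p ∈ f, u = (p.1, !ρ p.1) ∧ v = (p.2, ρ p.2)

/-- The extension of a strict order on `Q` to `Q × Bool`:
`(q,i) < (r,j)` iff (`i = -1` and `j = 1`), or (`q < r` and `i = j = 1`),
or (`q > r` and `i = j = -1`). -/
def ExtLt {Q : Type} (lt : Q → Q → Prop) : Q × Bool → Q × Bool → Prop :=
  fun x y =>
    (x.2 = false ∧ y.2 = true) ∨
    (lt x.1 y.1 ∧ x.2 = true ∧ y.2 = true) ∨
    (lt y.1 x.1 ∧ x.2 = false ∧ y.2 = false)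

/-- Planarity of a transition w.r.t. a direction map `ρ` and a strict total
order `lt`: no vertices `u < r < v < s` with an edge between `u` and `v`
(in either direction) and an edge between `r` and `s` (in either direction). -/
def IsPlanar {Q : Type} (ρ : Q → Bool) (lt : Q → Q → Prop) (f : Set (Q × Q)) : Prop :=
  ¬ ∃ u r v s : Q × Bool, ExtLt lt u r ∧ ExtLt lt r v ∧ ExtLt lt v s ∧
      (ProfileEdge ρ f u v ∨ ProfileEdge ρ f v u) ∧
      (ProfileEdge ρ f r s ∨ ProfileEdge ρ f s r)

/-- Deterministic transition: a partial function. -/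
def IsDet {Q : Type} (f : Set (Q × Q)) : Prop :=
  ∀ q r r', (q, r) ∈ f → (q, r') ∈ f → r = r'

/-- Reversible transition: a partial injection. -/
def IsRev {Q : Type} (f : Set (Q × Q)) : Prop :=
  IsDet f ∧ ∀ q q' r, (q, r) ∈ f → (q', r) ∈ f → q = q'

/-- Edges of the glued graph `C(ρ, f, g)` on `Q × Fin 3`, levels `0, 1, 2`
coding `-1, 0, 1`: the copy of `G(ρ,f)` lives on levels `{0,1}` (side `+1`
corresponding to level `1`) and the copy of `G(ρ,g)` on levels `{1,2}`
(side `+1` corresponding to level `2`). -/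
def GlueEdge {Q : Type} (ρ : Q → Bool) (f g : Set (Q × Q)) :
    Q × Fin 3 → Q × Fin 3 → Prop :=
  fun x y =>
    (x.2 ≠ 2 ∧ y.2 ≠ 2 ∧
      ProfileEdge ρ f (x.1, decide (x.2 = 1)) (y.1, decide (y.2 = 1))) ∨
    (x.2 ≠ 0 ∧ y.2 ≠ 0 ∧
      ProfileEdge ρ g (x.1, decide (x.2 = 2)) (y.1, decide (y.2 = 2)))

/-- Gluing composition `f * g` of transitions: `(q, r) ∈ f * g` iff there is a
directed path from `(q, -ρ q)` to `(r, ρ r)` in the glued graph `C(ρ, f, g)`. -/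
def glue {Q : Type} (ρ : Q → Bool) (f g : Set (Q × Q)) : Set (Q × Q) :=
  {p | Relation.ReflTransGen (GlueEdge ρ f g)
        (p.1, if ρ p.1 then (0 : Fin 3) else 2)
        (p.2, if ρ p.2 then (2 : Fin 3) else 0)}

/-- The identity transition, unit of the gluing composition. -/
def idRel (Q : Type) : Set (Q × Q) := {p | p.1 = p.2}

/-- Iterated gluing powers of a transition, with `glpow ρ f 0 = idRel Q`. -/
def glpow {Q : Type} (ρ : Q → Bool) (f : Set (Q × Q)) : ℕ → Set (Q × Q)
  | 0 => idRel Q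
  | n + 1 => glue ρ (glpow ρ f n) f

/-- A configuration of a two-way machine: the tape content to the left of the
head, the current state, and the tape content to the right of the head. -/
abbrev Config (Q A : Type) := List (Tape A) × Q × List (Tape A)

/-- The tape encoding `▷ u ◁` of an input word `u`. -/
def tapeOf {A : Type} (u : List A) : List (Tape A) :=
  Tape.lend :: (u.map Tape.sym ++ [Tape.rend])

/-- A two-way (nondeterministic) finite transducer. -/
structure TwoWayTransducer (Q A B : Type) where
  ρ : Q → Bool
  init : Q
  init_fwd : ρ init = true
  final : Set Q
  δ : Tape A → Set (Q × List B × Q)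

namespace TwoWayTransducer

variable {Q A B : Type}

/-- The transitions `⌊δ⌋(a)` of the underlying automaton. -/
def rel (T : TwoWayTransducer Q A B) (a : Tape A) : Set (Q × Q) :=
  {p | ∃ w, (p.1, w, p.2) ∈ T.δ a}

def Deterministic (T : TwoWayTransducer Q A B) : Prop :=
  ∀ a, IsDet (T.rel a)

def Reversible (T : TwoWayTransducer Q A B) : Prop :=
  ∀ a, IsRev (T.rel a)

def Planar (T : TwoWayTransducer Q A B) : Prop :=
  ∃ lt : Q → Q → Prop, IsStrictTotalOrder Q lt ∧
    ∀ a : A, IsPlanar T.ρ lt (T.rel (Tape.sym a))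

/-- One step of the two-way transducer, labelled by the output word. -/
def Step (T : TwoWayTransducer Q A B) (c : Config Q A) (w : List B)
    (c' : Config Q A) : Prop :=
  ∃ a u v q r, (q, w, r) ∈ T.δ a ∧
    ((T.ρ q = true ∧ T.ρ r = true ∧ c = (u, q, a :: v) ∧ c' = (u ++ [a], r, v)) ∨
     (T.ρ q = true ∧ T.ρ r = false ∧ c = (u, q, a :: v) ∧ c' = (u, r, a :: v)) ∨
     (T.ρ q = false ∧ T.ρ r = false ∧ c = (u ++ [a], q, v) ∧ c' = (u, r, a :: v)) ∨
     (T.ρ q = false ∧ T.ρ r = true ∧ c = (u ++ [a], q, v) ∧ c' = (u ++ [a], r, v)))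

/-- Multi-step runs, accumulating the concatenated output. -/
inductive Run (T : TwoWayTransducer Q A B) : Config Q A → List B → Config Q A → Prop
  | refl (c : Config Q A) : Run T c [] c
  | step {c₁ w₁ c₂ w₂ c₃} : Run T c₁ w₁ c₂ → T.Step c₂ w₂ c₃ → Run T c₁ (w₁ ++ w₂) c₃

/-- The pair `(u, v)` is realized by `T`. -/
def Realizes (T : TwoWayTransducer Q A B) (u : List A) (v : List B) : Prop :=
  ∃ qf ∈ T.final, T.Run ([], T.init, tapeOf u) v (tapeOf u, qf, [])

/-- `T` computes the partial function `f`. -/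
def Computes (T : TwoWayTransducer Q A B) (f : List A → Option (List B)) : Prop :=
  ∀ u v, f u = some v ↔ T.Realizes u v

end TwoWayTransducer

/-- Membership in the least submonoid of `B(Q,ρ)` containing the transitions
`⌊δ⌋(a)` for the input letters `a`. -/
inductive InBehav {Q A B : Type} (T : TwoWayTransducer Q A B) : Set (Q × Q) → Prop
  | one : InBehav T (idRel Q)
  | gen (a : A) : InBehav T (T.rel (Tape.sym a))
  | mul {f g} : InBehav T f → InBehav T g → InBehav T (glue T.ρ f g)

/-- The behaviour monoid `B(T)` is aperiodic. -/
def ApBehav {Q A B : Type} (T : TwoWayTransducer Q A B) : Prop :=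
  ∃ n : ℕ, ∀ f, InBehav T f → glpow T.ρ f (n + 1) = glpow T.ρ f n

/-- A first-order transduction: a partial function computed by some
deterministic two-way transducer whose behaviour monoid is aperiodic. -/
def IsFOTransduction {A B : Type} (f : List A → Option (List B)) : Prop :=
  ∃ (n : ℕ) (T : TwoWayTransducer (Fin n) A B),
    T.Deterministic ∧ ApBehav T ∧ T.Computes f

/-- A two-way (nondeterministic) finite automaton. -/
structure TwoWayAutomaton (Q A : Type) where
  ρ : Q → Bool
  init : Q
  init_fwd : ρ init = true
  final : Set Q
  δ : Tape A → Set (Q × Q)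

namespace TwoWayAutomaton

variable {Q A : Type}

def Deterministic (M : TwoWayAutomaton Q A) : Prop := ∀ a, IsDet (M.δ a)

def Reversible (M : TwoWayAutomaton Q A) : Prop := ∀ a, IsRev (M.δ a)

def Planar (M : TwoWayAutomaton Q A) : Prop :=
  ∃ lt : Q → Q → Prop, IsStrictTotalOrder Q lt ∧
    ∀ a : A, IsPlanar M.ρ lt (M.δ (Tape.sym a))

/-- One step of the two-way automaton. -/
def Step (M : TwoWayAutomaton Q A) (c c' : Config Q A) : Prop :=
  ∃ a u v q r, (q, r) ∈ M.δ a ∧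
    ((M.ρ q = true ∧ M.ρ r = true ∧ c = (u, q, a :: v) ∧ c' = (u ++ [a], r, v)) ∨
     (M.ρ q = true ∧ M.ρ r = false ∧ c = (u, q, a :: v) ∧ c' = (u, r, a :: v)) ∨
     (M.ρ q = false ∧ M.ρ r = false ∧ c = (u ++ [a], q, v) ∧ c' = (u, r, a :: v)) ∨
     (M.ρ q = false ∧ M.ρ r = true ∧ c = (u ++ [a], q, v) ∧ c' = (u ++ [a], r, v)))

def Accepts (M : TwoWayAutomaton Q A) (u : List A) : Prop :=
  ∃ qf ∈ M.final, Relation.ReflTransGen M.Step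
    ([], M.init, tapeOf u) (tapeOf u, qf, [])

def Language (M : TwoWayAutomaton Q A) : Set (List A) := {u | M.Accepts u}

end TwoWayAutomaton

/-- The underlying automaton `⌊T⌋` of a transducer `T`. -/
def forget {Q A B : Type} (T : TwoWayTransducer Q A B) : TwoWayAutomaton Q A :=
  { ρ := T.ρ, init := T.init, init_fwd := T.init_fwd, final := T.final,
    δ := fun a => T.rel a }

/-- Star-free languages: the smallest class containing all finite languages
and closed under finite union, complement and concatenation. -/
inductive StarFree {A : Type} : Set (List A) → Prop
  | of_finite (L : Set (List A)) : L.Finite → StarFree L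
  | union {L M : Set (List A)} : StarFree L → StarFree M → StarFree (L ∪ M)
  | compl {L : Set (List A)} : StarFree L → StarFree Lᶜ
  | concat {L M : Set (List A)} : StarFree L → StarFree M →
      StarFree {w | ∃ u ∈ L, ∃ v ∈ M, w = u ++ v}

/-- A (total, deterministic) sequential transducer. -/
structure SeqTransducer (Q A B : Type) where
  init : Q
  next : A → Q → Q
  out : A → Q → List B
  fin : Q → List B

namespace SeqTransducer

variable {Q A B : Type}

/-- Running a sequential transducer on a word from a state: final state and
produced output. -/
def run (T : SeqTransducer Q A B) : List A → Q → Q × List B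
  | [], q => (q, [])
  | a :: w, q =>
      let p := run T w (T.next a q)
      (p.1, T.out a q ++ p.2)

/-- The (total) sequential function computed by a sequential transducer. -/
def fn (T : SeqTransducer Q A B) (w : List A) : List B :=
  (T.run w T.init).2 ++ T.fin (T.run w T.init).1

end SeqTransducer

/-- Membership in the transition monoid of a sequential transducer, i.e. the
monoid of functions `Q → Q` generated by the `∂₁(a)`. -/
inductive SeqGen {Q A B : Type} (T : SeqTransducer Q A B) : (Q → Q) → Prop
  | id : SeqGen T id
  | gen (a : A) : SeqGen T (T.next a)
  | comp {h h'} : SeqGen T h → SeqGen T h' → SeqGen T (h ∘ h')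

/-- A sequential transducer is aperiodic when its transition monoid is. -/
def SeqTransducer.Aperiodic {Q A B : Type} (T : SeqTransducer Q A B) : Prop :=
  ∃ n : ℕ, ∀ h, SeqGen T h → h^[n + 1] = h^[n]


end Planar2DFT

namespace Planar2DFT

/-! ### Position based runs -/

/-- Labelled one-step relation of a two-way machine, on pairs (position, state). -/
def LSt {Q L B : Type} (ρ : Q → Bool) (D : L → Set (Q × List B × Q)) (W : List L)
    (c : ℕ × Q) (w : List B) (c' : ℕ × Q) : Prop :=
  ∃ i a, W[i]? = some a ∧ (c.2, w, c'.2) ∈ D a ∧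
    c.1 = i + (if ρ c.2 then 0 else 1) ∧ c'.1 = i + (if ρ c'.2 then 1 else 0)

/-- Labelled runs of a labelled step relation. -/
inductive LRun {α B : Type} (R : α → List B → α → Prop) : α → List B → α → Prop
  | refl (c : α) : LRun R c [] c
  | tail {a w b w' c} : LRun R a w b → R b w' c → LRun R a (w ++ w') c

theorem LRun.single {α B : Type} {R : α → List B → α → Prop} {a w b} (h : R a w b) :
    LRun R a w b := by
  simpa using LRun.tail (LRun.refl a) h

theorem LRun.trans {α B : Type} {R : α → List B → α → Prop} {a w b w' c}
    (h : LRun R a w b) (h' : LRun R b w' c) : LRun R a (w ++ w') c := by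
  induction h' with
  | refl => simpa using h
  | tail h1 h2 ih => rw [← List.append_assoc]; exact LRun.tail ih h2

theorem LRun.cast {α B : Type} {R : α → List B → α → Prop} {a w w' b}
    (h : LRun R a w b) (e : w = w') : LRun R a w' b := e ▸ h

theorem run_to_lrun {Q A B : Type} (T : TwoWayTransducer Q A B) {c₁ c₂ : Config Q A} {w : List B}
    (h : T.Run c₁ w c₂) : ∀ W, c₁.1 ++ c₁.2.2 = W →
      c₂.1 ++ c₂.2.2 = W ∧ LRun (LSt T.ρ T.δ W) (c₁.1.length, c₁.2.1) w (c₂.1.length, c₂.2.1) := by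
  induction h with
  | refl => intro W hW; exact ⟨hW, LRun.refl _⟩
  | step h1 h2 ih =>
    intro W hW
    obtain ⟨e, hr⟩ := ih W hW
    obtain ⟨a, u, v, q, r, hd, h⟩ := h2
    rcases h with ⟨hq, hr', rfl, rfl⟩ | ⟨hq, hr', rfl, rfl⟩ | ⟨hq, hr', rfl, rfl⟩ | ⟨hq, hr', rfl, rfl⟩ <;>
    · refine ⟨by simpa using e, LRun.tail hr ⟨u.length, a, ?_, hd, ?_, ?_⟩⟩
      · rw [← e]; simp
      · simp [hq]
      · simp [hr']

theorem lrun_to_run {Q A B : Type} (T : TwoWayTransducer Q A B) (W : List (Tape A)) {c c' : ℕ × Q}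
    {w : List B} (h : LRun (LSt T.ρ T.δ W) c w c') :
      T.Run (W.take c.1, c.2, W.drop c.1) w (W.take c'.1, c'.2, W.drop c'.1) := by
  induction h with
  | refl => exact .refl _
  | tail h1 h2 ih =>
    rename_i b w' c2
    refine .step ih ?_
    obtain ⟨i, a, hi, hd, h3, h4⟩ := h2
    obtain ⟨hlt, hia⟩ := List.getElem?_eq_some_iff.1 hi
    have hdrop : W.drop i = a :: W.drop (i+1) := by rw [← hia]; exact List.drop_eq_getElem_cons hlt
    have htake : W.take (i+1) = W.take i ++ [a] := by rw [← hia]; simp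
    refine ⟨a, W.take i, W.drop (i+1), b.2, c2.2, hd, ?_⟩
    cases hq : T.ρ b.2 <;> cases hr : T.ρ c2.2 <;> simp [hq, hr] at h3 h4 <;>
      simp [h3, h4, hdrop, htake]

theorem realizes_iff {Q A B : Type} (T : TwoWayTransducer Q A B) (u : List A) (v : List B) :
    T.Realizes u v ↔ ∃ qf ∈ T.final,
      LRun (LSt T.ρ T.δ (tapeOf u)) (0, T.init) v ((tapeOf u).length, qf) := by
  constructor
  · rintro ⟨qf, hf, h⟩
    exact ⟨qf, hf, (run_to_lrun T h _ rfl).2⟩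
  · rintro ⟨qf, hf, h⟩
    refine ⟨qf, hf, ?_⟩
    simpa using lrun_to_run T _ h

theorem tapeOf_length {A : Type} (u : List A) : (tapeOf u).length = u.length + 2 := by
  simp [tapeOf]

/-- `f` can be precomposed with planar reversible transducers. -/
def Good {A B : Type} (f : List A → List B) : Prop :=
  ∀ (C Q : Type) (_ : Finite Q) (T : TwoWayTransducer Q B C), T.Planar → T.Reversible →
    ∃ (Q' : Type) (_ : Finite Q') (T' : TwoWayTransducer Q' A C), T'.Planar ∧ T'.Reversible ∧
      ∀ u v, T'.Realizes u v ↔ T.Realizes (f u) v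

theorem Good.comp {A B C : Type} {f : List A → List B} {g : List B → List C}
    (hf : Good f) (hg : Good g) : Good (fun u => g (f u)) := by
  intro D Q hQ T hp hr
  obtain ⟨Q1, h1, T1, hp1, hr1, e1⟩ := hg D Q hQ T hp hr
  obtain ⟨Q2, h2, T2, hp2, hr2, e2⟩ := hf D Q1 h1 T1 hp1 hr1
  exact ⟨Q2, h2, T2, hp2, hr2, fun u v => (e2 u v).trans (e1 _ v)⟩

theorem Good.congr {A B : Type} {f g : List A → List B} (hf : Good f) (h : ∀ u, f u = g u) :
    Good g := by
  have : f = g := funext h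
  exact this ▸ hf

end Planar2DFT

namespace Planar2DFT

theorem LRun.seq {α B : Type} {R : α → List B → α → Prop} {a v b} (h : LRun R a v b) :
    ∃ (c : ℕ → α) (L : List (List B)), c 0 = a ∧ c L.length = b ∧
      (∀ i l, L[i]? = some l → R (c i) l (c (i+1))) ∧ v = L.flatten := by
  induction h with
  | refl => exact ⟨fun _ => a, [], by simp⟩
  | tail h1 h2 ih =>
    rename_i b w' d
    obtain ⟨c, L, h0, hN, hs, hv⟩ := ih
    refine ⟨fun i => if i ≤ L.length then c i else d, L ++ [w'], by simp [h0], by simp, ?_, by simp [hv]⟩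
    intro i l hl
    rcases lt_trichotomy i L.length with hi | hi | hi
    · have h1 : i ≤ L.length := hi.le
      have h2 : i + 1 ≤ L.length := hi
      simp only [h1, h2, if_true]
      apply hs
      rwa [List.getElem?_append_left hi] at hl
    · subst hi
      simp at hl
      subst hl
      simpa [hN] using h2
    · rw [List.getElem?_append_right hi.le] at hl
      have : i - L.length ≠ 0 := by omega
      obtain ⟨k, hk⟩ := Nat.exists_eq_succ_of_ne_zero this
      simp [hk] at hl

section Comp
variable {Q1 Q2 A B C : Type}

/-- Extension of the transitions of a transducer to words of length at most one. -/
def ext1 (T2 : TwoWayTransducer Q2 B C) : List (Tape B) → Set (Q2 × List C × Q2)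
  | [] => {p | p.2.1 = [] ∧ p.1 = p.2.2}
  | b :: _ => T2.δ b

/-- Composition. -/
def compT (T1 : TwoWayTransducer Q1 A (Tape B)) (T2 : TwoWayTransducer Q2 B C) :
    TwoWayTransducer (Q1 × Q2) A C where
  ρ q := (T1.ρ q.1 == T2.ρ q.2)
  init := (T1.init, T2.init)
  init_fwd := by simp [T1.init_fwd, T2.init_fwd]
  final := {q | q.2 ∈ T2.final}
  δ a := {p | ∃ q1 l r1 q2 w r2, (q1, l, r1) ∈ T1.δ a ∧ (q2, w, r2) ∈ ext1 T2 l ∧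
    p = ((if T2.ρ q2 then q1 else r1, q2), w, (if T2.ρ r2 then r1 else q1, r2))}

theorem LSt.det {Q L B : Type} {ρ : Q → Bool} {D : L → Set (Q × List B × Q)} {W : List L}
    (hD : ∀ a q w r w' r', (q, w, r) ∈ D a → (q, w', r') ∈ D a → w = w' ∧ r = r')
    {c w c' w' c''} (h : LSt ρ D W c w c') (h' : LSt ρ D W c w' c'') : w = w' ∧ c' = c'' := by
  obtain ⟨i, a, hi, hd, h1, h2⟩ := h
  obtain ⟨i', a', hi', hd', h1', h2'⟩ := h'
  have : i = i' := by omega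
  subst this
  rw [hi] at hi'; cases hi'
  obtain ⟨e1, e2⟩ := hD _ _ _ _ _ _ hd hd'
  exact ⟨e1, Prod.ext (by rw [h2, h2', e2]) e2⟩

theorem LSt.codet {Q L B : Type} {ρ : Q → Bool} {D : L → Set (Q × List B × Q)} {W : List L}
    (hD : ∀ a q w r w' q', (q, w, r) ∈ D a → (q', w', r) ∈ D a → w = w' ∧ q = q')
    {c w c' w' c''} (h : LSt ρ D W c' w c) (h' : LSt ρ D W c'' w' c) : w = w' ∧ c' = c'' := by
  obtain ⟨i, a, hi, hd, h1, h2⟩ := h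
  obtain ⟨i', a', hi', hd', h1', h2'⟩ := h'
  have : i = i' := by omega
  subst this
  rw [hi] at hi'; cases hi'
  obtain ⟨e1, e2⟩ := hD _ _ _ _ _ _ hd hd'
  exact ⟨e1, Prod.ext (by rw [h1, h1', e2]) e2⟩

/-- One step of the composite is a step of `T2` along the run of `T1`. -/
theorem comp_step (T1 : TwoWayTransducer Q1 A (Tape B)) (T2 : TwoWayTransducer Q2 B C)
    (hdet : ∀ a q w r w' r', (q, w, r) ∈ T1.δ a → (q, w', r') ∈ T1.δ a → w = w' ∧ r = r')
    (hcodet : ∀ a q w r w' q', (q, w, r) ∈ T1.δ a → (q', w', r) ∈ T1.δ a → w = w' ∧ q = q')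
    (W : List (Tape A)) (c : ℕ → ℕ × Q1) (L : List (List (Tape B))) (qf : Q1)
    (h0 : c 0 = (0, T1.init)) (hN : c L.length = (W.length, qf)) (hqf : T1.ρ qf = true)
    (hs : ∀ i l, L[i]? = some l → LSt T1.ρ T1.δ W (c i) l (c (i+1)))
    (t : ℕ) (ht : t ≤ L.length) (q2 : Q2) (w : List C) (d : ℕ × (Q1 × Q2)) :
    LSt (compT T1 T2).ρ (compT T1 T2).δ W ((c t).1, (c t).2, q2) w d ↔
      ∃ t' r2, t' ≤ L.length ∧ d = ((c t').1, (c t').2, r2) ∧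
        LSt T2.ρ (ext1 T2) L (t, q2) w (t', r2) := by
  constructor
  · rintro ⟨i, a, hi, ⟨q1, l, r1, q2', w', r2, hd1, hd2, heq⟩, h1, h2⟩
    simp only [Prod.mk.injEq] at heq
    obtain ⟨⟨e1, rfl⟩, rfl, e2⟩ := heq
    have key : ∃ s, L[s]? = some l ∧ c s = (i + (if T1.ρ q1 then 0 else 1), q1) ∧
        c (s+1) = (i + (if T1.ρ r1 then 1 else 0), r1) ∧
        t = s + (if T2.ρ q2 then 0 else 1) := by
      have hstep : LSt T1.ρ T1.δ W (i + (if T1.ρ q1 then 0 else 1), q1) l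
          (i + (if T1.ρ r1 then 1 else 0), r1) := ⟨i, a, hi, hd1, rfl, rfl⟩
      cases hq : T2.ρ q2
      · -- backward
        simp [hq] at e1
        have hct : c t = (i + (if T1.ρ r1 then 1 else 0), r1) := by
          refine Prod.ext ?_ e1
          simp only [compT, hq, e1] at h1
          rw [h1]
          cases T1.ρ r1 <;> simp
        have ht0 : t ≠ 0 := by
          rintro rfl
          rw [h0] at hct
          simp only [Prod.mk.injEq] at hct
          obtain ⟨e3, e4⟩ := hct
          rw [← e4, T1.init_fwd] at e3
          simp at e3
        obtain ⟨s, rfl⟩ := Nat.exists_eq_succ_of_ne_zero ht0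
        have hsl : s < L.length := ht
        have hs' := hs s _ (List.getElem?_eq_getElem hsl)
        rw [Nat.succ_eq_add_one] at hct
        rw [hct] at hs'
        obtain ⟨e5, e6⟩ := LSt.codet hcodet hs' hstep
        exact ⟨s, by rw [List.getElem?_eq_getElem hsl, e5], e6, hct, by simp⟩
      · simp [hq] at e1
        have hct : c t = (i + (if T1.ρ q1 then 0 else 1), q1) := by
          refine Prod.ext ?_ e1
          simp only [compT, hq, e1] at h1
          rw [h1]
          cases T1.ρ q1 <;> simp
        have htl : t < L.length := by
          rcases ht.lt_or_eq with h | h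
          · exact h
          · exfalso
            rw [h, hN] at hct
            simp only [Prod.mk.injEq] at hct
            obtain ⟨e3, e4⟩ := hct
            have := (List.getElem?_eq_some_iff.1 hi).1
            rw [← e4, hqf] at e3
            simp at e3
            omega
        have hs' := hs t _ (List.getElem?_eq_getElem htl)
        rw [hct] at hs'
        obtain ⟨e5, e6⟩ := LSt.det hdet hs' hstep
        exact ⟨t, by rw [List.getElem?_eq_getElem htl, e5], hct, e6, by simp⟩
    obtain ⟨s, hl, hc1, hc2, hts⟩ := key
    have hsl := (List.getElem?_eq_some_iff.1 hl).1
    refine ⟨s + (if T2.ρ r2 then 1 else 0), r2, by split_ifs <;> omega, ?_, s, l, hl, hd2, hts, rfl⟩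
    obtain ⟨d1, d2⟩ := d
    simp only at e2
    subst e2
    simp only at h2
    rw [h2]
    cases hr : T2.ρ r2
    · simp only [hr, compT, Bool.false_eq_true, if_false, Nat.add_zero, hc1]
      refine Prod.ext ?_ rfl
      cases T1.ρ q1 <;> simp
    · simp only [hr, compT, if_true, hc2]
      refine Prod.ext ?_ rfl
      cases T1.ρ r1 <;> simp
  · rintro ⟨t', r2, ht', rfl, s, l, hl, hd2, h1, h2⟩
    obtain ⟨i, a, hi, hd1, h3, h4⟩ := hs s l hl
    simp only at h1 h2 hd2
    refine ⟨i, a, hi, ⟨(c s).2, l, (c (s+1)).2, q2, w, r2, hd1, hd2, ?_⟩, ?_, ?_⟩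
    · rw [h1, h2]
      cases T2.ρ q2 <;> cases T2.ρ r2 <;> simp
    · rw [h1]
      cases hq : T2.ρ q2
      · simp only [compT, hq, Bool.false_eq_true, if_false, h4]
        cases T1.ρ (c (s+1)).2 <;> simp
      · simp only [compT, hq, if_true, Nat.add_zero, h3]
        cases T1.ρ (c s).2 <;> simp
    · rw [h2]
      cases hq : T2.ρ r2
      · simp only [compT, hq, Bool.false_eq_true, if_false, Nat.add_zero, h3]
        cases T1.ρ (c s).2 <;> simp
      · simp only [compT, hq, if_true, h4]
        cases T1.ρ (c (s+1)).2 <;> simp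

/-! Deleting silent cells. -/

/-- Number of letters in the first `t` cells. -/
def flatLen (L : List (List (Tape B))) (t : ℕ) : ℕ := (L.take t).flatten.length

theorem flatLen_succ (L : List (List (Tape B))) {t : ℕ} {l} (h : L[t]? = some l) :
    flatLen L (t+1) = flatLen L t + l.length := by
  obtain ⟨h1, h2⟩ := List.getElem?_eq_some_iff.1 h
  simp only [flatLen]
  rw [← List.take_concat_get' (h := h1)]
  simp [h2]

theorem flatLen_mono (L : List (List (Tape B))) {s t : ℕ} (h : s ≤ t) : flatLen L s ≤ flatLen L t := by
  induction h with
  | refl => exact le_rfl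
  | step h ih =>
    rename_i m
    refine ih.trans ?_
    cases hm : L[m]? with
    | none =>
      have := List.getElem?_eq_none_iff.1 hm
      simp only [flatLen]
      rw [List.take_of_length_le this, List.take_of_length_le (by omega)]
    | some l => rw [Nat.succ_eq_add_one, flatLen_succ L hm]; omega

theorem flatLen_get (L : List (List (Tape B))) {t : ℕ} {b l} (h : L[t]? = some (b :: l)) :
    L.flatten[flatLen L t]? = some b := by
  obtain ⟨h1, h2⟩ := List.getElem?_eq_some_iff.1 h
  have : L = L.take t ++ (b :: l) :: L.drop (t+1) := by
    rw [← h2, ← List.drop_eq_getElem_cons h1, List.take_append_drop]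
  conv_lhs => rw [this]
  rw [List.flatten_append, List.getElem?_append_right (by rw [← this]; exact le_rfl)]
  rw [← this]
  simp [flatLen]

theorem exists_cell (L : List (List (Tape B))) (hL : ∀ l ∈ L, l.length ≤ 1) {p : ℕ} {b}
    (h : L.flatten[p]? = some b) : ∃ t, L[t]? = some [b] ∧ flatLen L t = p := by
  have hp := (List.getElem?_eq_some_iff.1 h).1
  have hex : ∃ t, p < flatLen L t := ⟨L.length, by simpa [flatLen] using hp⟩
  classical
  have h1 := Nat.find_spec hex
  have h2 := fun m => Nat.find_min hex (m := m)
  generalize Nat.find hex = t at h1 h2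
  have ht : t ≠ 0 := by rintro rfl; simp [flatLen] at h1
  obtain ⟨s, rfl⟩ := Nat.exists_eq_succ_of_ne_zero ht
  have h3 := h2 s (Nat.lt_succ_self s)
  rw [Nat.succ_eq_add_one] at h1
  cases hm : L[s]? with
  | none =>
    have := List.getElem?_eq_none_iff.1 hm
    simp only [flatLen] at h1 h3
    rw [List.take_of_length_le (by omega)] at h1 h3
    omega
  | some l =>
    have hl := hL l (List.mem_of_getElem? hm)
    rw [flatLen_succ L hm] at h1
    have hsp : flatLen L s = p := by omega
    refine ⟨s, ?_, hsp⟩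
    match l, hl, h1, hm with
    | [], _, h1, _ => simp at h1; omega
    | [b'], _, _, hm =>
      have := flatLen_get L hm
      rw [hsp, h] at this
      cases this
      exact hm

theorem silent_fwd (T2 : TwoWayTransducer Q2 B C) (L : List (List (Tape B))) (q : Q2)
    (hq : T2.ρ q = true) {s t : ℕ} (h : s ≤ t) (ht : t ≤ L.length) (he : flatLen L s = flatLen L t) :
    LRun (LSt T2.ρ (ext1 T2) L) (s, q) [] (t, q) := by
  induction h with
  | refl => exact .refl _
  | step h ih =>
    rename_i m
    have hm : m < L.length := ht
    have h1 := flatLen_mono L h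
    have h2 := flatLen_succ L (List.getElem?_eq_getElem hm)
    rw [Nat.succ_eq_add_one] at he
    have h3 : L[m] = [] := List.length_eq_zero_iff.1 (by omega)
    refine (LRun.tail (ih hm.le (by omega)) (w' := []) ⟨m, [], ?_, ?_, ?_, ?_⟩)
    · rw [List.getElem?_eq_getElem hm, h3]
    · simp [ext1]
    · simp [hq]
    · simp [hq]

theorem silent_bwd (T2 : TwoWayTransducer Q2 B C) (L : List (List (Tape B))) (q : Q2)
    (hq : T2.ρ q = false) {s t : ℕ} (h : s ≤ t) (ht : t ≤ L.length) (he : flatLen L s = flatLen L t) :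
    LRun (LSt T2.ρ (ext1 T2) L) (t, q) [] (s, q) := by
  induction h with
  | refl => exact .refl _
  | step h ih =>
    rename_i m
    have hm : m < L.length := ht
    have h1 := flatLen_mono L h
    have h2 := flatLen_succ L (List.getElem?_eq_getElem hm)
    rw [Nat.succ_eq_add_one] at he
    have h3 : L[m] = [] := List.length_eq_zero_iff.1 (by omega)
    refine (LRun.trans (LRun.single (w := []) ⟨m, [], ?_, ?_, ?_, ?_⟩) (ih hm.le (by omega)))
    · rw [List.getElem?_eq_getElem hm, h3]
    · simp [ext1]
    · simp [hq]
    · simp [hq]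

theorem flat_run (T2 : TwoWayTransducer Q2 B C) (L : List (List (Tape B)))
    (hL : ∀ l ∈ L, l.length ≤ 1) (q0 qf : Q2) (hqf : T2.ρ qf = true) (v : List C) :
    LRun (LSt T2.ρ (ext1 T2) L) (0, q0) v (L.length, qf) ↔
    LRun (LSt T2.ρ T2.δ L.flatten) (0, q0) v (L.flatten.length, qf) := by
  constructor
  · intro h
    have key : ∀ c v c', LRun (LSt T2.ρ (ext1 T2) L) c v c' →
        LRun (LSt T2.ρ T2.δ L.flatten) (flatLen L c.1, c.2) v (flatLen L c'.1, c'.2) := by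
      intro c v c' h
      induction h with
      | refl => exact .refl _
      | tail h1 h2 ih =>
        rename_i b w' c'
        obtain ⟨i, a, hi, hd, h3, h4⟩ := h2
        match a, hL a (List.mem_of_getElem? hi), hi, hd with
        | [], _, hi, hd =>
          obtain ⟨e1, e2⟩ := hd
          simp only at e1 e2
          have hs := flatLen_succ L hi
          simp only [List.length_nil, Nat.add_zero] at hs
          have : flatLen L c'.1 = flatLen L b.1 := by
            rw [h3, h4, e2]; split_ifs <;> simp [hs]
          rw [this, e1, List.append_nil, ← e2]
          exact ih
        | [x], _, hi, hd =>
          have hs := flatLen_succ L hi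
          simp only [List.length_singleton] at hs
          refine LRun.tail ih ⟨flatLen L i, x, flatLen_get L hi, hd, ?_, ?_⟩
          · simp only [h3]; split_ifs <;> simp [hs]
          · simp only [h4]; split_ifs <;> simp [hs]
    have := key _ _ _ h
    simpa [flatLen] using this
  · intro h
    have key : ∀ c v c', LRun (LSt T2.ρ T2.δ L.flatten) c v c' → c = (0, q0) →
        ∃ t, t ≤ L.length ∧ flatLen L t = c'.1 ∧
          LRun (LSt T2.ρ (ext1 T2) L) (0, q0) v (t, c'.2) := by
      intro c v c' h hc
      induction h with
      | refl => subst hc; exact ⟨0, by omega, by simp [flatLen], .refl _⟩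
      | tail h1 h2 ih =>
        rename_i b w' c'
        obtain ⟨t, ht, hf, hr⟩ := ih
        obtain ⟨i, a, hi, hd, h3, h4⟩ := h2
        obtain ⟨s, hs, hsf⟩ := exists_cell L hL hi
        have hsl := (List.getElem?_eq_some_iff.1 hs).1
        have hsucc := flatLen_succ L hs
        simp only [List.length_singleton] at hsucc
        have hsil : LRun (LSt T2.ρ (ext1 T2) L) (t, b.2) [] (s + (if T2.ρ b.2 then 0 else 1), b.2) := by
          cases hb : T2.ρ b.2
          · simp only [hb, Bool.false_eq_true, if_false] at h3 ⊢
            refine silent_bwd T2 L _ hb ?_ ht (by omega)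
            by_contra hlt
            have := flatLen_mono L (show t ≤ s by omega)
            omega
          · simp only [hb, if_true, Nat.add_zero] at h3 ⊢
            refine silent_fwd T2 L _ hb ?_ hsl.le (by omega)
            by_contra hlt
            have := flatLen_mono L (show s + 1 ≤ t by omega)
            omega
        refine ⟨s + (if T2.ρ c'.2 then 1 else 0), by split_ifs <;> omega, ?_, ?_⟩
        · rw [h4]; split_ifs <;> (try simp only [Nat.add_zero]) <;> omega
        · have := LRun.trans hr hsil
          rw [List.append_nil] at this
          exact LRun.tail this ⟨s, [a], hs, hd, rfl, rfl⟩
    obtain ⟨t, ht, hf, hr⟩ := key _ _ _ h rfl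
    have := hr.trans (silent_fwd T2 L qf hqf ht le_rfl (by rw [hf]; simp [flatLen]))
    simpa using this

theorem final_fwd {Q L B : Type} {ρ : Q → Bool} {D : L → Set (Q × List B × Q)} {W : List L}
    {q0 qf : Q} {v : List B} (h : LRun (LSt ρ D W) (0, q0) v (W.length, qf)) (hW : W ≠ []) :
    ρ qf = true := by
  generalize hc : (W.length, qf) = c at h
  generalize hd : ((0 : ℕ), q0) = d at h
  cases h with
  | refl => subst hd; simp at hc; exact absurd hc.1 hW
  | tail h1 h2 =>
    subst hc
    obtain ⟨i, a, hi, hd, h3, h4⟩ := h2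
    have := (List.getElem?_eq_some_iff.1 hi).1
    simp only at h4
    by_contra hne
    simp [hne] at h4
    omega

theorem comp_realizes (T1 : TwoWayTransducer Q1 A (Tape B)) (T2 : TwoWayTransducer Q2 B C)
    (hdet : ∀ a q w r w' r', (q, w, r) ∈ T1.δ a → (q, w', r') ∈ T1.δ a → w = w' ∧ r = r')
    (hcodet : ∀ a q w r w' q', (q, w, r) ∈ T1.δ a → (q', w', r) ∈ T1.δ a → w = w' ∧ q = q')
    (hlen : ∀ a q w r, (q, w, r) ∈ T1.δ a → w.length ≤ 1)
    (u : List A) (x : List B) (h1 : T1.Realizes u (tapeOf x)) (v : List C) :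
    (compT T1 T2).Realizes u v ↔ T2.Realizes x v := by
  rw [realizes_iff] at h1
  obtain ⟨qf1, -, hr1⟩ := h1
  have hqf1 := final_fwd hr1 (by simp [tapeOf])
  obtain ⟨c, L, h0, hN, hs, hv⟩ := hr1.seq
  have hL : ∀ l ∈ L, l.length ≤ 1 := by
    intro l hl
    obtain ⟨i, hi, rfl⟩ := List.mem_iff_getElem.1 hl
    obtain ⟨j, a, _, hd, _⟩ := hs i _ (List.getElem?_eq_getElem hi)
    exact hlen _ _ _ _ hd
  have step := comp_step T1 T2 hdet hcodet (tapeOf u) c L qf1 h0 hN hqf1 hs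
  rw [realizes_iff, realizes_iff]
  have hinj : ∀ t, t ≤ L.length → (c t).1 = (tapeOf u).length → T1.ρ (c t).2 = true → t = L.length := by
    intro t ht h h'
    rcases ht.lt_or_eq with hlt | he
    · obtain ⟨i, a, hi, hd, h3, h4⟩ := hs t _ (List.getElem?_eq_getElem hlt)
      have := (List.getElem?_eq_some_iff.1 hi).1
      simp [h'] at h3
      omega
    · exact he
  constructor
  · rintro ⟨⟨p1, p2⟩, hp, hr⟩
    have key : ∀ d v d', LRun (LSt (compT T1 T2).ρ (compT T1 T2).δ (tapeOf u)) d v d' →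
        d = (0, T1.init, T2.init) → ∃ t q2, t ≤ L.length ∧ d' = ((c t).1, (c t).2, q2) ∧
          LRun (LSt T2.ρ (ext1 T2) L) (0, T2.init) v (t, q2) := by
      intro d v d' h hd
      induction h with
      | refl => subst hd; exact ⟨0, T2.init, by omega, by rw [h0], .refl _⟩
      | tail h1 h2 ih =>
        obtain ⟨t, q2, ht, rfl, hr⟩ := ih
        obtain ⟨t', r2, ht', rfl, hst⟩ := (step t ht q2 _ _).1 h2
        exact ⟨t', r2, ht', rfl, hr.tail hst⟩
    obtain ⟨t, q2, ht, he, hr2⟩ := key _ _ _ hr rfl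
    have hfw := final_fwd hr (by simp [tapeOf])
    simp only [Prod.mk.injEq] at he
    obtain ⟨e1, rfl, rfl⟩ := he
    have htL : t = L.length := by
      rcases ht.lt_or_eq with hlt | he
      · by_cases hb : T1.ρ (c t).2 = true
        · exact hinj t ht e1.symm hb
        · exfalso
          rcases Nat.eq_zero_or_pos t with rfl | hpos
          · rw [h0] at hb; exact hb T1.init_fwd
          · obtain ⟨s, rfl⟩ := Nat.exists_eq_succ_of_ne_zero hpos.ne'
            obtain ⟨i, a, hi, hd, h3, h4⟩ := hs s _ (List.getElem?_eq_getElem (by omega))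
            have := (List.getElem?_eq_some_iff.1 hi).1
            rw [Nat.succ_eq_add_one] at hb e1
            simp [hb] at h4
            omega
      · exact he
    subst htL
    have hfw2 : T2.ρ p2 = true := by
      rw [hN] at hfw
      simpa [compT, hqf1] using hfw
    have := (flat_run T2 L hL _ _ hfw2 v).1 hr2
    rw [← hv] at this
    exact ⟨p2, hp, this⟩
  · rintro ⟨q2, hq2, hr2⟩
    have hfw2 := final_fwd hr2 (by simp [tapeOf])
    rw [hv] at hr2
    have hr := (flat_run T2 L hL _ _ hfw2 v).2 hr2
    refine ⟨(qf1, q2), hq2, ?_⟩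
    have key : ∀ d v d', LRun (LSt T2.ρ (ext1 T2) L) d v d' → d.1 ≤ L.length → d'.1 ≤ L.length ∧
        LRun (LSt (compT T1 T2).ρ (compT T1 T2).δ (tapeOf u)) ((c d.1).1, (c d.1).2, d.2) v
          ((c d'.1).1, (c d'.1).2, d'.2) := by
      intro d v d' h hd
      induction h with
      | refl => exact ⟨hd, .refl _⟩
      | tail h1 h2 ih =>
        rename_i b w' d'
        have hle : d'.1 ≤ L.length := by
          obtain ⟨i, a, hi, hd, h3, h4⟩ := h2
          have := (List.getElem?_eq_some_iff.1 hi).1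
          rw [h4]; split_ifs <;> omega
        exact ⟨hle, ih.2.tail ((step b.1 ih.1 b.2 _ _).2 ⟨d'.1, d'.2, hle, rfl, h2⟩)⟩
    have := (key _ _ _ hr (by simp)).2
    simp only [h0, hN] at this
    exact this

end Comp
end Planar2DFT

namespace Planar2DFT

section Order
variable {Q : Type} {lt : Q → Q → Prop}

theorem lt_tri (h : IsStrictTotalOrder Q lt) (a b : Q) : lt a b ∨ a = b ∨ lt b a :=
  trichotomous_of lt a b

theorem mk_sto (h1 : ∀ a, ¬ lt a a) (h2 : ∀ a b c, lt a b → lt b c → lt a c)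
    (h3 : ∀ a b, lt a b ∨ a = b ∨ lt b a) : IsStrictTotalOrder Q lt :=
  { irrefl := h1, trans := h2, trichotomous := fun a b ha hb => by
      rcases h3 a b with h | h | h
      · exact absurd h ha
      · exact h
      · exact absurd h hb }

theorem ExtLt.irrefl (h : IsStrictTotalOrder Q lt) (x : Q × Bool) : ¬ ExtLt lt x x := by
  rintro (⟨h1, h2⟩ | ⟨h1, -⟩ | ⟨h1, -⟩)
  · rw [h1] at h2; cases h2
  · exact irrefl_of lt _ h1
  · exact irrefl_of lt _ h1

theorem ExtLt.trans (h : IsStrictTotalOrder Q lt) {x y z : Q × Bool} (h1 : ExtLt lt x y)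
    (h2 : ExtLt lt y z) : ExtLt lt x z := by
  have ht := fun a b c => trans_of lt (a := a) (b := b) (c := c)
  unfold ExtLt at *
  rcases h1 with ⟨a, b⟩ | ⟨a, b, c⟩ | ⟨a, b, c⟩ <;> rcases h2 with ⟨d, e⟩ | ⟨d, e, f⟩ | ⟨d, e, f⟩ <;>
    simp_all
  · exact ht _ _ _ a d
  · exact ht _ _ _ d a

theorem ExtLt.tri (h : IsStrictTotalOrder Q lt) (x y : Q × Bool) :
    ExtLt lt x y ∨ x = y ∨ ExtLt lt y x := by
  obtain ⟨a, i⟩ := x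
  obtain ⟨b, j⟩ := y
  unfold ExtLt
  rcases lt_tri h a b with h | h | h <;> cases i <;> cases j <;> simp [h]

/-- Planarity from a rank function. -/
theorem planar_of_rank {ρ : Q → Bool} {f : Set (Q × Q)} (rk : Q → ℤ) (h0 : ∀ q, 0 ≤ rk q)
    (H : ∀ q r q' r', (q, r) ∈ f → (q', r') ∈ f →
      ∀ a b a' b' : ℤ, a = (if ρ q then - 1 - rk q else rk q) → b = (if ρ r then rk r else - 1 - rk r) →
        a' = (if ρ q' then - 1 - rk q' else rk q') → b' = (if ρ r' then rk r' else - 1 - rk r') →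
        ¬ (min a b < min a' b' ∧ min a' b' < max a b ∧ max a b < max a' b')) :
    IsPlanar ρ (fun x y => rk x < rk y) f := by
  have hpos : ∀ x y : Q × Bool, ExtLt (fun x y => rk x < rk y) x y →
      (if x.2 then rk x.1 else - 1 - rk x.1) < (if y.2 then rk y.1 else - 1 - rk y.1) := by
    rintro ⟨x, i⟩ ⟨y, j⟩ h
    have hx := h0 x
    have hy := h0 y
    unfold ExtLt at h
    cases i <;> cases j <;> simp at h ⊢ <;> omega
  rintro ⟨u, r, v, s, h1, h2, h3, e1, e2⟩
  have g1 := hpos _ _ h1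
  have g2 := hpos _ _ h2
  have g3 := hpos _ _ h3
  have key : ∀ x y : Q × Bool, (ProfileEdge ρ f x y ∨ ProfileEdge ρ f y x) →
      ∃ q r, (q, r) ∈ f ∧
        (((if x.2 then rk x.1 else - 1 - rk x.1) = (if ρ q then - 1 - rk q else rk q) ∧
          (if y.2 then rk y.1 else - 1 - rk y.1) = (if ρ r then rk r else - 1 - rk r)) ∨
         ((if y.2 then rk y.1 else - 1 - rk y.1) = (if ρ q then - 1 - rk q else rk q) ∧
          (if x.2 then rk x.1 else - 1 - rk x.1) = (if ρ r then rk r else - 1 - rk r))) := by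
    rintro x y (⟨⟨q, r⟩, hf, rfl, rfl⟩ | ⟨⟨q, r⟩, hf, rfl, rfl⟩)
    · refine ⟨q, r, hf, Or.inl ⟨?_, rfl⟩⟩
      cases hq : ρ q <;> simp [hq]
    · refine ⟨q, r, hf, Or.inr ⟨?_, rfl⟩⟩
      cases hq : ρ q <;> simp [hq]
  obtain ⟨q, t, hf, k1⟩ := key _ _ e1
  obtain ⟨q', t', hf', k2⟩ := key _ _ e2
  have := H q t q' t' hf hf' _ _ _ _ rfl rfl rfl rfl
  apply this
  rcases k1 with ⟨k1, k1'⟩ | ⟨k1, k1'⟩ <;> rcases k2 with ⟨k2, k2'⟩ | ⟨k2, k2'⟩ <;>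
    rw [← k1, ← k1', ← k2, ← k2'] <;> omega

theorem rank_sto (rk : Q → ℤ) (hinj : Function.Injective rk) :
    IsStrictTotalOrder Q (fun x y => rk x < rk y) :=
  mk_sto (fun a => lt_irrefl _) (fun a b c => lt_trans) (fun a b => by
    rcases lt_trichotomy (rk a) (rk b) with h | h | h
    · exact Or.inl h
    · exact Or.inr (Or.inl (hinj h))
    · exact Or.inr (Or.inr h))

theorem planar_id {ρ : Q → Bool} (h : IsStrictTotalOrder Q lt) {f : Set (Q × Q)}
    (hf : ∀ p ∈ f, p.1 = p.2) : IsPlanar ρ lt f := by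
  rintro ⟨u, r, v, s, h1, h2, h3, e1, e2⟩
  have key : ∀ x y : Q × Bool, (ProfileEdge ρ f x y ∨ ProfileEdge ρ f y x) →
      ExtLt lt x y → x.1 = y.1 ∧ x.2 = false ∧ y.2 = true := by
    intro x y he hl
    have h1 : x.1 = y.1 ∧ x.2 = !y.2 := by
      rcases he with ⟨⟨q, r⟩, hm, rfl, rfl⟩ | ⟨⟨q, r⟩, hm, rfl, rfl⟩ <;>
      · have := hf _ hm
        simp only at this
        subst this
        simp
    rcases hl with ⟨a, b⟩ | ⟨a, b, c⟩ | ⟨a, b, c⟩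
    · exact ⟨h1.1, a, b⟩
    · rw [b, c] at h1; simp at h1
    · rw [b, c] at h1; simp at h1
  obtain ⟨a1, a2, a3⟩ := key _ _ e1 (h1.trans h h2)
  obtain ⟨b1, b2, b3⟩ := key _ _ e2 (h2.trans h h3)
  unfold ExtLt at h1 h3
  simp [a2, b2] at h1
  simp [a3, b3] at h3
  rw [a1, b1] at h1
  exact irrefl_of lt _ (trans_of lt h1 h3)

end Order

section Comp
variable {Q1 Q2 A B C : Type}

/-- Order on the states of the composite. -/
def compLt (ρ1 : Q1 → Bool) (lt1 : Q1 → Q1 → Prop) (lt2 : Q2 → Q2 → Prop) (a b : Q1 × Q2) : Prop :=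
  lt1 a.1 b.1 ∨ (a.1 = b.1 ∧ (if ρ1 a.1 then lt2 a.2 b.2 else lt2 b.2 a.2))

theorem compLt_sto (ρ1 : Q1 → Bool) {lt1 : Q1 → Q1 → Prop} {lt2 : Q2 → Q2 → Prop}
    (h1 : IsStrictTotalOrder Q1 lt1) (h2 : IsStrictTotalOrder Q2 lt2) :
    IsStrictTotalOrder (Q1 × Q2) (compLt ρ1 lt1 lt2) := by
  refine mk_sto ?_ ?_ ?_
  · rintro ⟨a, b⟩ (h | ⟨-, h⟩)
    · exact irrefl_of lt1 _ h
    · simp only at h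
      split_ifs at h <;> exact irrefl_of lt2 _ h
  · rintro ⟨a, b⟩ ⟨a', b'⟩ ⟨a'', b''⟩ (h | ⟨e, h⟩) (g | ⟨e', g⟩)
    · exact Or.inl (trans_of lt1 h g)
    · simp only at e' h; subst e'; exact Or.inl h
    · simp only at e g; subst e; exact Or.inl g
    · simp only at e e' h g; subst e; subst e'
      refine Or.inr ⟨rfl, ?_⟩
      simp only
      split_ifs at h g ⊢
      · exact trans_of lt2 h g
      · exact trans_of lt2 g h
  · rintro ⟨a, b⟩ ⟨a', b'⟩
    rcases lt_tri h1 a a' with h | rfl | h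
    · exact Or.inl (Or.inl h)
    · rcases lt_tri h2 b b' with g | rfl | g
      · cases hr : ρ1 a <;> simp [compLt, hr, g]
      · simp
      · cases hr : ρ1 a <;> simp [compLt, hr, g]
    · exact Or.inr (Or.inr (Or.inl h))

/-- `T2`-vertex underlying a composite vertex. -/
def tau (ρ1 : Q1 → Bool) (X : (Q1 × Q2) × Bool) : Q2 × Bool := (X.1.2, X.2 == ρ1 X.1.1)

/-- `T1`-vertex underlying a composite vertex. -/
def pi1 (X : (Q1 × Q2) × Bool) : Q1 × Bool := (X.1.1, X.2)

theorem comp_ord (ρ1 : Q1 → Bool) {lt1 : Q1 → Q1 → Prop} {lt2 : Q2 → Q2 → Prop}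
    {X Y : (Q1 × Q2) × Bool} (h : ExtLt (compLt ρ1 lt1 lt2) X Y) :
    ExtLt lt1 (pi1 X) (pi1 Y) ∨ (pi1 X = pi1 Y ∧ (tau ρ1 X).2 = (tau ρ1 Y).2 ∧
      ExtLt lt2 (tau ρ1 X) (tau ρ1 Y)) := by
  obtain ⟨⟨x1, x2⟩, i⟩ := X
  obtain ⟨⟨y1, y2⟩, j⟩ := Y
  unfold ExtLt compLt at h
  unfold ExtLt pi1 tau
  rcases h with ⟨a, b⟩ | ⟨a | ⟨e, a⟩, b, c⟩ | ⟨a | ⟨e, a⟩, b, c⟩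
  · left; left; exact ⟨a, b⟩
  · left; right; left; exact ⟨a, b, c⟩
  · right
    simp only at e b c a
    subst e b c
    cases hr : ρ1 x1 <;> simp [hr] at a ⊢ <;> exact a
  · left; right; right; exact ⟨a, b, c⟩
  · right
    simp only at e b c a
    subst e b c
    cases hr : ρ1 y1 <;> simp [hr] at a ⊢ <;> exact a

/-- Underlying relation of `ext1`. -/
def rel1 (T2 : TwoWayTransducer Q2 B C) (l : List (Tape B)) : Set (Q2 × Q2) :=
  {p | ∃ w, (p.1, w, p.2) ∈ ext1 T2 l}

theorem comp_edge (T1 : TwoWayTransducer Q1 A (Tape B)) (T2 : TwoWayTransducer Q2 B C) (a : Tape A)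
    {X Y : (Q1 × Q2) × Bool}
    (h : ProfileEdge (compT T1 T2).ρ ((compT T1 T2).rel a) X Y) :
    ∃ q1 l r1, (q1, l, r1) ∈ T1.δ a ∧
      ProfileEdge T2.ρ (rel1 T2 l) (tau T1.ρ X) (tau T1.ρ Y) ∧
      pi1 X = (if (tau T1.ρ X).2 then (r1, T1.ρ r1) else (q1, !T1.ρ q1)) ∧
      pi1 Y = (if (tau T1.ρ Y).2 then (r1, T1.ρ r1) else (q1, !T1.ρ q1)) := by
  obtain ⟨⟨s, t⟩, ⟨w, q1, l, r1, q2, w', r2, hd1, hd2, heq⟩, rfl, rfl⟩ := h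
  simp only [Prod.mk.injEq] at heq
  obtain ⟨rfl, rfl, rfl⟩ := heq
  refine ⟨q1, l, r1, hd1, ⟨(q2, r2), ⟨w, hd2⟩, ?_, ?_⟩, ?_, ?_⟩
  · cases h : T2.ρ q2 <;> cases h' : T1.ρ q1 <;> cases h'' : T1.ρ r1 <;> simp [tau, compT, h, h', h'']
  · cases h : T2.ρ r2 <;> cases h' : T1.ρ q1 <;> cases h'' : T1.ρ r1 <;> simp [tau, compT, h, h', h'']
  · cases h : T2.ρ q2 <;> cases h' : T1.ρ q1 <;> cases h'' : T1.ρ r1 <;>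
      simp [tau, compT, pi1, h, h', h'']
  · cases h : T2.ρ r2 <;> cases h' : T1.ρ q1 <;> cases h'' : T1.ρ r1 <;>
      simp [tau, compT, pi1, h, h', h'']

theorem comp_planar (T1 : TwoWayTransducer Q1 A (Tape B)) (T2 : TwoWayTransducer Q2 B C) (a : Tape A)
    (hdet : ∀ a q w r w' r', (q, w, r) ∈ T1.δ a → (q, w', r') ∈ T1.δ a → w = w' ∧ r = r')
    (hcodet : ∀ a q w r w' q', (q, w, r) ∈ T1.δ a → (q', w', r) ∈ T1.δ a → w = w' ∧ q = q')
    {lt1 : Q1 → Q1 → Prop} {lt2 : Q2 → Q2 → Prop}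
    (h1 : IsStrictTotalOrder Q1 lt1) (h2 : IsStrictTotalOrder Q2 lt2)
    (hp1 : IsPlanar T1.ρ lt1 (T1.rel a))
    (hp2 : ∀ q l r, (q, l, r) ∈ T1.δ a → IsPlanar T2.ρ lt2 (rel1 T2 l)) :
    IsPlanar (compT T1 T2).ρ (compLt T1.ρ lt1 lt2) ((compT T1 T2).rel a) := by
  rintro ⟨U, R, V, S, hUR, hRV, hVS, e1, e2⟩
  have edge : ∀ X Y, (ProfileEdge (compT T1 T2).ρ ((compT T1 T2).rel a) X Y ∨
      ProfileEdge (compT T1 T2).ρ ((compT T1 T2).rel a) Y X) → ∃ q1 l r1, (q1, l, r1) ∈ T1.δ a ∧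
      (ProfileEdge T2.ρ (rel1 T2 l) (tau T1.ρ X) (tau T1.ρ Y) ∨
        ProfileEdge T2.ρ (rel1 T2 l) (tau T1.ρ Y) (tau T1.ρ X)) ∧
      pi1 X = (if (tau T1.ρ X).2 then (r1, T1.ρ r1) else (q1, !T1.ρ q1)) ∧
      pi1 Y = (if (tau T1.ρ Y).2 then (r1, T1.ρ r1) else (q1, !T1.ρ q1)) := by
    rintro X Y (h | h)
    · obtain ⟨q1, l, r1, a1, a2, a3, a4⟩ := comp_edge T1 T2 a h
      exact ⟨q1, l, r1, a1, Or.inl a2, a3, a4⟩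
    · obtain ⟨q1, l, r1, a1, a2, a3, a4⟩ := comp_edge T1 T2 a h
      exact ⟨q1, l, r1, a1, Or.inr a2, a4, a3⟩
  obtain ⟨q, l, r, hd, eUV, pU, pV⟩ := edge _ _ e1
  obtain ⟨q', l', r', hd', eRS, pR, pS⟩ := edge _ _ e2
  by_cases hqq : q = q'
  · subst hqq
    obtain ⟨rfl, rfl⟩ := hdet _ _ _ _ _ _ hd hd'
    have hp := hp2 _ _ _ hd
    have hne : ((r, T1.ρ r) : Q1 × Bool) ≠ (q, !T1.ρ q) := by
      intro h
      simp only [Prod.mk.injEq] at h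
      obtain ⟨rfl, h⟩ := h
      simp at h
    have irr := ExtLt.irrefl h1
    rcases ExtLt.tri h1 (q, !T1.ρ q) (r, T1.ρ r) with hlt | he | hlt
    · have key : ∀ X Y, ExtLt (compLt T1.ρ lt1 lt2) X Y →
          pi1 X = (if (tau T1.ρ X).2 then (r, T1.ρ r) else (q, !T1.ρ q)) →
          pi1 Y = (if (tau T1.ρ Y).2 then (r, T1.ρ r) else (q, !T1.ρ q)) →
          ExtLt lt2 (tau T1.ρ X) (tau T1.ρ Y) := by
        intro X Y hXY hX hY
        rcases comp_ord _ hXY with h | ⟨-, -, h⟩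
        · rw [hX, hY] at h
          cases hx : (tau T1.ρ X).2 <;> cases hy : (tau T1.ρ Y).2 <;> simp [hx, hy] at h
          · exact absurd h (irr _)
          · exact Or.inl ⟨hx, hy⟩
          · exact absurd (hlt.trans h1 h) (irr _)
          · exact absurd h (irr _)
        · exact h
      exact hp ⟨_, _, _, _, key _ _ hUR pU pR, key _ _ hRV pR pV, key _ _ hVS pV pS, eUV, eRS⟩
    · exact hne he.symm
    · have key : ∀ X Y, ExtLt (compLt T1.ρ lt1 lt2) X Y →
          pi1 X = (if (tau T1.ρ X).2 then (r, T1.ρ r) else (q, !T1.ρ q)) →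
          pi1 Y = (if (tau T1.ρ Y).2 then (r, T1.ρ r) else (q, !T1.ρ q)) →
          ((tau T1.ρ X).2 = (tau T1.ρ Y).2 ∧ ExtLt lt2 (tau T1.ρ X) (tau T1.ρ Y)) ∨
          ((tau T1.ρ X).2 = true ∧ (tau T1.ρ Y).2 = false) := by
        intro X Y hXY hX hY
        rcases comp_ord _ hXY with h | ⟨-, h', h⟩
        · rw [hX, hY] at h
          cases hx : (tau T1.ρ X).2 <;> cases hy : (tau T1.ρ Y).2 <;> simp [hx, hy] at h
          · exact absurd h (irr _)
          · exact absurd (hlt.trans h1 h) (irr _)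
          · simp
          · exact absurd h (irr _)
        · exact Or.inl ⟨h', h⟩
      have flip : ∀ X Y : Q2 × Bool, X.2 = true → Y.2 = false → ExtLt lt2 Y X :=
        fun X Y hx hy => Or.inl ⟨hy, hx⟩
      rcases key _ _ hUR pU pR with ⟨s1, k1⟩ | ⟨s1, s1'⟩ <;>
      rcases key _ _ hRV pR pV with ⟨s2, k2⟩ | ⟨s2, s2'⟩ <;>
      rcases key _ _ hVS pV pS with ⟨s3, k3⟩ | ⟨s3, s3'⟩ 
      · exact hp ⟨_, _, _, _, k1, k2, k3, eUV, eRS⟩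
      · exact hp ⟨_, _, _, _, flip _ _ (s1.trans (s2.trans s3)) s3', k1, k2, eRS.symm, eUV⟩
      · exact hp ⟨_, _, _, _, k3, flip _ _ (s1.trans s2) (s3 ▸ s2'), k1, eUV.symm, eRS.symm⟩
      · rw [s2'] at s3; cases s3
      · exact hp ⟨_, _, _, _, k2, k3, flip _ _ s1 (s3 ▸ s2 ▸ s1'), eRS, eUV.symm⟩
      · rw [← s2, s1'] at s3; cases s3
      · rw [s1'] at s2; cases s2
      · rw [s1'] at s2; cases s2
  · have hrr : r ≠ r' := by
      rintro rfl
      exact hqq (hcodet _ _ _ _ _ _ hd hd').2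
    have disj : ∀ b b' : Bool, (if b then (r, T1.ρ r) else (q, !T1.ρ q)) ≠
        (if b' then (r', T1.ρ r') else (q', !T1.ρ q')) := by
      intro b b' h
      cases b <;> cases b' <;> simp at h
      · exact hqq h.1
      · obtain ⟨rfl, h⟩ := h; simp at h
      · obtain ⟨rfl, h⟩ := h; simp at h
      · exact hrr h.1
    have g1 : ExtLt lt1 (pi1 U) (pi1 R) := by
      rcases comp_ord _ hUR with h | ⟨h, -⟩
      · exact h
      · rw [pU, pR] at h; exact absurd h (disj _ _)
    have g2 : ExtLt lt1 (pi1 R) (pi1 V) := by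
      rcases comp_ord _ hRV with h | ⟨h, -⟩
      · exact h
      · rw [pR, pV] at h; exact absurd h.symm (disj _ _)
    have g3 : ExtLt lt1 (pi1 V) (pi1 S) := by
      rcases comp_ord _ hVS with h | ⟨h, -⟩
      · exact h
      · rw [pV, pS] at h; exact absurd h (disj _ _)
    have mk : ∀ (q l r) (b b' : Bool), (q, l, r) ∈ T1.δ a →
        ExtLt lt1 (if b then (r, T1.ρ r) else (q, !T1.ρ q)) (if b' then (r, T1.ρ r) else (q, !T1.ρ q)) →
        ProfileEdge T1.ρ (T1.rel a) (if b then (r, T1.ρ r) else (q, !T1.ρ q))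
          (if b' then (r, T1.ρ r) else (q, !T1.ρ q)) ∨
        ProfileEdge T1.ρ (T1.rel a) (if b' then (r, T1.ρ r) else (q, !T1.ρ q))
          (if b then (r, T1.ρ r) else (q, !T1.ρ q)) := by
      intro q l r b b' hd h
      cases b <;> cases b' <;> simp at h ⊢
      · exact absurd h (ExtLt.irrefl h1 _)
      · exact Or.inl ⟨(q, r), ⟨l, hd⟩, rfl, rfl⟩
      · exact Or.inr ⟨(q, r), ⟨l, hd⟩, rfl, rfl⟩
      · exact absurd h (ExtLt.irrefl h1 _)
    have gUV := g1.trans h1 g2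
    have gRS := g2.trans h1 g3
    refine hp1 ⟨_, _, _, _, g1, g2, g3, ?_, ?_⟩
    · rw [pU, pV] at gUV ⊢; exact mk _ _ _ _ _ hd gUV
    · rw [pR, pS] at gRS ⊢; exact mk _ _ _ _ _ hd' gRS

theorem comp_rev (T1 : TwoWayTransducer Q1 A (Tape B)) (T2 : TwoWayTransducer Q2 B C)
    (hdet : ∀ a q w r w' r', (q, w, r) ∈ T1.δ a → (q, w', r') ∈ T1.δ a → w = w' ∧ r = r')
    (hcodet : ∀ a q w r w' q', (q, w, r) ∈ T1.δ a → (q', w', r) ∈ T1.δ a → w = w' ∧ q = q')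
    (hr2 : T2.Reversible) : (compT T1 T2).Reversible := by
  have hrel : ∀ l, IsRev (rel1 T2 l) := by
    intro l
    cases l with
    | nil =>
      constructor
      · rintro q r r' ⟨w, -, h⟩ ⟨w', -, h'⟩; exact h.symm.trans h'
      · rintro q r r' ⟨w, -, h⟩ ⟨w', -, h'⟩; exact h.trans h'.symm
    | cons b l => exact hr2 b
  intro a
  constructor
  · rintro s t t' ⟨w, q1, l, r1, q2, w1, r2, hd1, hd2, heq⟩ ⟨w', q1', l', r1', q2', w1', r2', hd1', hd2', heq'⟩
    simp only [Prod.mk.injEq] at heq heq'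
    obtain ⟨rfl, rfl, rfl⟩ := heq
    obtain ⟨h1, rfl, rfl⟩ := heq'
    simp only [Prod.mk.injEq] at h1
    obtain ⟨h1, rfl⟩ := h1
    have : l = l' ∧ q1 = q1' ∧ r1 = r1' := by
      split_ifs at h1
      · subst h1; obtain ⟨h3, h4⟩ := hdet _ _ _ _ _ _ hd1 hd1'; exact ⟨h3, rfl, h4⟩
      · subst h1; obtain ⟨h3, h4⟩ := hcodet _ _ _ _ _ _ hd1 hd1'; exact ⟨h3, h4, rfl⟩
    obtain ⟨rfl, rfl, rfl⟩ := this
    have := (hrel l).1 q2 r2 r2' ⟨_, hd2⟩ ⟨_, hd2'⟩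
    subst this
    rfl
  · rintro s s' t ⟨w, q1, l, r1, q2, w1, r2, hd1, hd2, heq⟩ ⟨w', q1', l', r1', q2', w1', r2', hd1', hd2', heq'⟩
    simp only [Prod.mk.injEq] at heq heq'
    obtain ⟨rfl, rfl, rfl⟩ := heq
    obtain ⟨rfl, rfl, h1⟩ := heq'
    simp only [Prod.mk.injEq] at h1
    obtain ⟨h1, rfl⟩ := h1
    have : l = l' ∧ q1 = q1' ∧ r1 = r1' := by
      split_ifs at h1
      · subst h1; obtain ⟨h3, h4⟩ := hcodet _ _ _ _ _ _ hd1 hd1'; exact ⟨h3, h4, rfl⟩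
      · subst h1; obtain ⟨h3, h4⟩ := hdet _ _ _ _ _ _ hd1 hd1'; exact ⟨h3, rfl, h4⟩
    obtain ⟨rfl, rfl, rfl⟩ := this
    have := (hrel l).2 q2 q2' r2 ⟨_, hd2⟩ ⟨_, hd2'⟩
    subst this
    rfl

/-- A planar reversible machine producing at most one letter per transition can be precomposed. -/
theorem good_of_machine [Finite Q1] (f : List A → List B) (T1 : TwoWayTransducer Q1 A (Tape B))
    (hdet : ∀ a q w r w' r', (q, w, r) ∈ T1.δ a → (q, w', r') ∈ T1.δ a → w = w' ∧ r = r')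
    (hcodet : ∀ a q w r w' q', (q, w, r) ∈ T1.δ a → (q', w', r) ∈ T1.δ a → w = w' ∧ q = q')
    (hlen : ∀ a q w r, (q, w, r) ∈ T1.δ a → w.length ≤ 1)
    (hsym : ∀ a q w r, (q, w, r) ∈ T1.δ (Tape.sym a) → w = [] ∨ ∃ b, w = [Tape.sym b])
    (hp : T1.Planar) (hf : ∀ u, T1.Realizes u (tapeOf (f u))) : Good f := by
  intro C Q2 hQ2 T2 hp2 hr2
  obtain ⟨lt1, h1, hp1⟩ := hp
  obtain ⟨lt2, h2, hp2⟩ := hp2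
  refine ⟨Q1 × Q2, inferInstance, compT T1 T2, ⟨compLt T1.ρ lt1 lt2, compLt_sto _ h1 h2, ?_⟩,
    comp_rev T1 T2 hdet hcodet hr2, ?_⟩
  · intro a
    refine comp_planar T1 T2 _ hdet hcodet h1 h2 (hp1 a) ?_
    intro q l r hd
    rcases hsym _ _ _ _ hd with rfl | ⟨b, rfl⟩
    · apply planar_id h2
      rintro p ⟨w, -, h⟩
      exact h
    · exact hp2 b
  · intro u v
    exact comp_realizes T1 T2 hdet hcodet hlen u (f u) (hf u) v

end Comp
end Planar2DFT

namespace Planar2DFT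

/-- Machine given by a partial step function. -/
def mkT {Q A B : Type} (ρ : Q → Bool) (q0 : Q) (h0 : ρ q0 = true)
    (st : Tape A → Q → Option (List B × Q)) : TwoWayTransducer Q A B where
  ρ := ρ
  init := q0
  init_fwd := h0
  final := Set.univ
  δ a := {x | st a x.1 = some (x.2.1, x.2.2)}

theorem good_mk {Q A B : Type} [Finite Q] (f : List A → List B) (ρ : Q → Bool) (q0 : Q)
    (h0 : ρ q0 = true) (st : Tape A → Q → Option (List (Tape B) × Q))
    (hcodet : ∀ a q w r w' q', st a q = some (w, r) → st a q' = some (w', r) → q = q')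
    (hlen : ∀ a q w r, st a q = some (w, r) → w.length ≤ 1)
    (hsym : ∀ a q w r, st (Tape.sym a) q = some (w, r) → w = [] ∨ ∃ b, w = [Tape.sym b])
    (rk : Q → ℤ) (hinj : Function.Injective rk) (hnn : ∀ q, 0 ≤ rk q)
    (hp : ∀ x q r q' r' w w', st (Tape.sym x) q = some (w, r) → st (Tape.sym x) q' = some (w', r') →
      ∀ a b a' b' : ℤ, a = (if ρ q then - 1 - rk q else rk q) → b = (if ρ r then rk r else - 1 - rk r) →
        a' = (if ρ q' then - 1 - rk q' else rk q') → b' = (if ρ r' then rk r' else - 1 - rk r') →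
        ¬ (min a b < min a' b' ∧ min a' b' < max a b ∧ max a b < max a' b'))
    (hf : ∀ u, ∃ qf, LRun (LSt ρ (mkT ρ q0 h0 st).δ (tapeOf u)) (0, q0) (tapeOf (f u))
      ((tapeOf u).length, qf)) : Good f := by
  refine good_of_machine f (mkT ρ q0 h0 st) ?_ ?_ ?_ ?_ ?_ ?_
  · intro a q w r w' r' h h'
    simp only [mkT, Set.mem_ofPred_eq] at h h'
    rw [h] at h'
    simpa using h'
  · intro a q w r w' q' h h'
    simp only [mkT, Set.mem_ofPred_eq] at h h'
    obtain rfl := hcodet _ _ _ _ _ _ h h'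
    rw [h] at h'
    simpa using h'
  · intro a q w r h
    exact hlen _ _ _ _ h
  · intro a q w r h
    exact hsym _ _ _ _ h
  · refine ⟨_, rank_sto rk hinj, fun x => planar_of_rank rk hnn ?_⟩
    rintro q r q' r' ⟨w, h⟩ ⟨w', h'⟩
    exact hp x q r q' r' w w' h h'
  · intro u
    rw [realizes_iff]
    obtain ⟨qf, h⟩ := hf u
    exact ⟨qf, trivial, h⟩

theorem lst_mk {Q A B : Type} {ρ : Q → Bool} {q0 : Q} {h0 : ρ q0 = true}
    {st : Tape A → Q → Option (List B × Q)} {W : List (Tape A)} (i : ℕ) (a : Tape A)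
    (hi : W[i]? = some a) {q w r} (h : st a q = some (w, r)) (j k : ℕ)
    (hj : j = i + (if ρ q then 0 else 1)) (hk : k = i + (if ρ r then 1 else 0)) :
    LRun (LSt ρ (mkT ρ q0 h0 st).δ W) (j, q) w (k, r) :=
  LRun.single ⟨i, a, hi, h, hj, hk⟩

theorem tape_lend {A : Type} (u : List A) : (tapeOf u)[0]? = some Tape.lend := rfl

theorem tape_rend {A : Type} (u : List A) : (tapeOf u)[u.length + 1]? = some Tape.rend := by
  simp [tapeOf]

theorem tape_sym {A : Type} (p : List A) (a : A) (s : List A) :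
    (tapeOf (p ++ a :: s))[p.length + 1]? = some (Tape.sym a) := by
  simp [tapeOf]

section Reset
variable {A B S : Type}

/-- Identity-reset sequential function. -/
def idr (act : A → Option S) (out : A → S → B) : List A → S → List B
  | [], _ => []
  | a :: u, s => out a s :: idr act out u ((act a).getD s)

/-- Direction. -/
def idrRho : Option (S × Bool) → Bool
  | none => true
  | some (_, b) => b

open Classical in
/-- Step function of the reset machine. -/
noncomputable def idrSt (act : A → Option S) (out : A → S → B) (s0 : S) :
    Tape A → Option (S × Bool) → Option (List (Tape B) × Option (S × Bool))
  | .lend, some (s, true) => if s = s0 then some ([.lend], some (s, true)) else none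
  | .lend, some (s, false) => if s = s0 then some ([], none) else none
  | .lend, none => none
  | .rend, some (s, true) => some ([.rend], some (s, true))
  | .rend, _ => none
  | .sym a, some (s, true) =>
    match act a with
    | none => some ([.sym (out a s)], some (s, true))
    | some _ => some ([.sym (out a s)], some (s, false))
  | .sym a, some (s, false) =>
    match act a with
    | none => some ([], some (s, false))
    | some p => if s = p then some ([], none) else none
  | .sym a, none =>
    match act a with
    | none => some ([], none)
    | some p => some ([], some (p, true))

theorem idr_run (act : A → Option S) (out : A → S → B) (s0 : S) (suf : List A) :
    ∀ (pre : List A) (s : S),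
      LRun (LSt idrRho (mkT idrRho (some (s0, true)) rfl (idrSt act out s0)).δ (tapeOf (pre ++ suf)))
        (pre.length + 1, some (s, false)) [] (pre.length + 1, none) →
      ∃ t, LRun (LSt idrRho (mkT idrRho (some (s0, true)) rfl (idrSt act out s0)).δ (tapeOf (pre ++ suf)))
        (pre.length + 1, some (s, true)) ((idr act out suf s).map Tape.sym)
        ((pre ++ suf).length + 1, some (t, true)) := by
  induction suf with
  | nil =>
    intro pre s _
    exact ⟨s, by simpa [idr] using LRun.refl _⟩
  | cons a suf ih =>
    intro pre s hb
    have ht := tape_sym pre a suf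
    have ih := ih (pre ++ [a]) ((act a).getD s)
    simp only [List.append_assoc, List.singleton_append, List.length_append, List.length_singleton] at ih
    cases ha : act a with
    | none =>
      simp only [ha, Option.getD_none] at ih
      obtain ⟨t, h⟩ := ih (LRun.cast ((lst_mk (pre.length + 1) _ ht (w := []) (r := some (s, false)) (by simp [idrSt, ha]) _
        (pre.length + 1) (by simp [idrRho]) (by simp [idrRho])).trans (hb.trans (lst_mk (pre.length + 1) _ ht
          (w := []) (r := none) (by simp [idrSt, ha]) _ _ (by simp [idrRho]) (by simp [idrRho])))) (by simp))
      refine ⟨t, ?_⟩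
      have h1 := (lst_mk (q0 := some (s0, true)) (h0 := rfl) (st := idrSt act out s0) (ρ := idrRho) (pre.length + 1) _ ht
        (q := some (s, true)) (w := [Tape.sym (out a s)]) (r := some (s, true)) (by simp [idrSt, ha]) (pre.length + 1)
        (pre.length + 1 + 1) (by simp [idrRho]) (by simp [idrRho])).trans h
      simpa [idr, ha] using h1
    | some p =>
      simp only [ha, Option.getD_some] at ih
      obtain ⟨t, h⟩ := ih (lst_mk (pre.length + 1) _ ht (w := []) (by simp [idrSt, ha]) _
        _ (by simp [idrRho]) (by simp [idrRho]))
      refine ⟨t, ?_⟩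
      have h1 := (lst_mk (q0 := some (s0, true)) (h0 := rfl) (st := idrSt act out s0) (ρ := idrRho) (pre.length + 1) _ ht
        (q := some (s, true)) (w := [Tape.sym (out a s)]) (r := some (s, false)) (by simp [idrSt, ha])
        (pre.length + 1) (pre.length + 1) (by simp [idrRho]) (by simp [idrRho])).trans
        (hb.trans ((lst_mk (pre.length + 1) _ ht (w := []) (r := some (p, true)) (by simp [idrSt, ha]) _ (pre.length + 1 + 1)
          (by simp [idrRho]) (by simp [idrRho])).trans h))
      simpa [idr, ha] using h1

theorem good_idr [Finite S] (act : A → Option S) (out : A → S → B) (s0 : S) :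
    Good (fun u => idr act out u s0) := by
  classical
  obtain ⟨n, ⟨e⟩⟩ := Finite.exists_equiv_fin S
  refine good_mk _ idrRho (some (s0, true)) rfl (idrSt act out s0) ?_ ?_ ?_
    (fun x => match x with | none => 2 * n | some (s, true) => 2 * (e s).1 | some (s, false) => 2 * (e s).1 + 1)
    ?_ ?_ ?_ ?_
  · rintro a q w r w' q' h h'
    rcases a with _ | _ | a <;> rcases q with _ | ⟨s, _ | _⟩ <;> rcases q' with _ | ⟨s', _ | _⟩ <;>
      simp [idrSt] at h h' <;> (try (cases ha : act a <;> simp [ha] at h h')) <;> grind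
  · rintro a q w r h
    rcases a with _ | _ | a <;> rcases q with _ | ⟨s, _ | _⟩ <;> 
      simp [idrSt] at h <;> (try (cases ha : act a <;> simp [ha] at h)) <;> grind
  · rintro a q w r h
    rcases q with _ | ⟨s, _ | _⟩ <;> 
      simp [idrSt] at h <;> (cases ha : act a <;> simp [ha] at h) <;> grind
  · have he : ∀ s s' : S, (e s).1 = (e s').1 → s = s' := fun s s' h => e.injective (Fin.ext h)
    rintro (_ | ⟨s, _ | _⟩) (_ | ⟨s', _ | _⟩) h <;> simp at h ⊢
    · have := (e s').2; omega
    · have := (e s').2; omega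
    · have := (e s).2; omega
    · exact he _ _ (by omega)
    · omega
    · have := (e s).2; omega
    · omega
    · exact he _ _ (by omega)
  · rintro (_ | ⟨s, _ | _⟩) <;> simp; omega
  · rintro x q r q' r' w w' h h' a b a' b' ea eb ea' eb'
    have he : ∀ s s' : S, (e s).1 = (e s').1 ∨ (e s).1 ≠ (e s').1 := fun s s' => em _
    cases ha : act x with
    | none =>
      rcases q with _ | ⟨s, _ | _⟩ <;> rcases q' with _ | ⟨s', _ | _⟩ <;>
      simp only [idrSt, ha, Option.some.injEq, Prod.mk.injEq] at h h' <;> 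
      obtain ⟨-, rfl⟩ := h <;> obtain ⟨-, rfl⟩ := h' <;>
      simp [idrRho] at ea eb ea' eb' <;> omega
    | some p =>
      have hp := (e p).2
      rcases q with _ | ⟨s, _ | _⟩ <;> rcases q' with _ | ⟨s', _ | _⟩ <;>
      simp only [idrSt, ha, Option.some.injEq, Prod.mk.injEq, Option.ite_none_right_eq_some] at h h' <;> 
      (first | obtain ⟨-, rfl⟩ := h | obtain ⟨rfl, -, rfl⟩ := h) <;>
      (first | obtain ⟨-, rfl⟩ := h' | obtain ⟨rfl, -, rfl⟩ := h') <;>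
      simp [idrRho] at ea eb ea' eb' <;>
      (try have hs := (e s).2) <;> (try have hs' := (e s').2) <;> omega
  · intro u
    obtain ⟨t, h⟩ := idr_run act out s0 u [] s0 (lst_mk 0 _ rfl (by simp [idrSt]) _ _ rfl rfl)
    refine ⟨some (t, true), ?_⟩
    have h1 := (lst_mk (q0 := some (s0, true)) (h0 := rfl) (st := idrSt act out s0) (ρ := idrRho) 0 _ (tape_lend u)
        (q := some (s0, true)) (w := [Tape.lend]) (r := some (s0, true)) (by simp [idrSt])
        0 1 (by simp [idrRho]) (by simp [idrRho])).trans
        (h.trans (lst_mk (u.length + 1) _ (tape_rend u) (w := [Tape.rend]) (r := some (t, true)) (by simp [idrSt]) _ (u.length + 1 + 1)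
          (by simp [idrRho]) (by simp [idrRho])))
    simpa [tapeOf] using h1

theorem good_map (h : A → B) : Good (List.map h) := by
  refine (good_idr (S := Unit) (fun _ => none) (fun a _ => h a) ()).congr ?_
  intro u
  induction u with
  | nil => rfl
  | cons a u ih => simpa [idr] using ih

end Reset

section Reverse
variable {A : Type}

def revSt : Tape A → Fin 3 → Option (List (Tape A) × Fin 3)
  | .lend, 0 => some ([.lend], 0)
  | .lend, 1 => some ([], 2)
  | .lend, 2 => none
  | .sym _, 0 => some ([], 0)
  | .sym a, 1 => some ([.sym a], 1)
  | .sym _, 2 => some ([], 2)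
  | .rend, 0 => some ([], 1)
  | .rend, 1 => none
  | .rend, 2 => some ([.rend], 2)

def revRho (q : Fin 3) : Bool := q != 1

theorem rev_fwd (q : Fin 3) (hq : q ≠ 1) (suf : List A) : ∀ pre : List A,
      LRun (LSt revRho (mkT revRho 0 rfl revSt).δ (tapeOf (pre ++ suf)))
        (pre.length + 1, q) [] ((pre ++ suf).length + 1, q) := by
  induction suf with
  | nil => intro pre; simpa using LRun.refl _
  | cons a suf ih =>
    intro pre
    have ih := ih (pre ++ [a])
    simp only [List.append_assoc, List.singleton_append, List.length_append, List.length_singleton] at ih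
    have h1 := (lst_mk (q0 := 0) (h0 := rfl) (st := revSt) (ρ := revRho) (pre.length + 1) _ (tape_sym pre a suf)
        (q := q) (w := []) (r := q) (by fin_cases q <;> simp_all [revSt])
        (pre.length + 1) (pre.length + 1 + 1) (by fin_cases q <;> simp_all [revRho]) (by fin_cases q <;> simp_all [revRho])).trans ih
    simpa using h1

theorem rev_bwd (pre : List A) : ∀ suf : List A,
      LRun (LSt revRho (mkT revRho 0 rfl revSt).δ (tapeOf (pre ++ suf)))
        (pre.length + 1, 1) (pre.reverse.map Tape.sym) (1, 1) := by
  induction pre using List.reverseRecOn with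
  | nil => intro pre; simpa using LRun.refl _
  | append_singleton pre a ih =>
    intro suf
    have ih := ih (a :: suf)
    have h1 := (lst_mk (q0 := 0) (h0 := rfl) (st := revSt) (ρ := revRho) (pre.length + 1) _ (tape_sym pre a suf)
        (q := 1) (w := [.sym a]) (r := 1) (by simp_all [revSt])
        (pre.length + 1 + 1) (pre.length + 1) (by simp_all [revRho]) (by simp_all [revRho])).trans ih
    simpa using h1

theorem good_reverse : Good (List.reverse : List A → List A) := by
  refine good_mk _ revRho 0 rfl revSt ?_ ?_ ?_ (fun x => x.1) ?_ ?_ ?_ ?_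
  · rintro a q w r w' q' h h'
    rcases a with _ | _ | a <;> fin_cases q <;> fin_cases q' <;> simp [revSt] at h h' ⊢ <;> simp [← h.2] at h'
  · rintro a q w r h
    rcases a with _ | _ | a <;> fin_cases q <;> simp [revSt] at h <;> first | simp [h.1] | simp [← h.1]
  · rintro a q w r h
    fin_cases q <;> simp [revSt] at h <;> first | simp [h.1] | simp [← h.1]
  · intro x y h; simp at h; omega
  · intro x; simp
  · rintro x q r q' r' w w' h h' a b a' b' ea eb ea' eb'
    fin_cases q <;> fin_cases q' <;> simp only [revSt, Option.some.injEq, Prod.mk.injEq] at h h' <;> 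
      obtain ⟨-, rfl⟩ := h <;> obtain ⟨-, rfl⟩ := h' <;> simp [revRho] at ea eb ea' eb' <;> omega
  · intro u
    refine ⟨2, ?_⟩
    have hb := rev_bwd u []
    have h0 := rev_fwd 0 (by simp) u []
    have h2 := rev_fwd 2 (by simp) u []
    rw [List.append_nil] at hb
    rw [List.nil_append] at h0 h2
    have h := ((((lst_mk (q0 := 0) (h0 := rfl) (st := revSt) (ρ := revRho) 0 _ (tape_lend u)
        (q := 0) (w := [.lend]) (r := 0) rfl 0 1 rfl rfl).trans h0).trans 
        (lst_mk (u.length+1) _ (tape_rend u) (w := []) (r := 1) rfl _ (u.length + 1) rfl rfl)).trans hb).trans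
        ((lst_mk 0 _ (tape_lend u) (q := 1) (w := []) (r := 2) rfl 1 1 rfl rfl).trans (h2.trans
        (lst_mk (u.length+1) _ (tape_rend u) (q := 2) (w := [.rend]) (r := 2) rfl (u.length + 1) (u.length + 2) rfl rfl)))
    simpa [tapeOf] using h

end Reverse

section Ins
variable {A : Type}

def insSt : Tape A → Fin 7 → Option (List (Tape (Tape A)) × Fin 7)
  | .lend, 0 => some ([.lend], 1)
  | .lend, 2 => some ([.sym .lend], 3)
  | .lend, 4 => some ([], 5)
  | .lend, _ => none
  | .sym _, 1 => some ([], 2)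
  | .sym a, 3 => some ([.sym (.sym a)], 3)
  | .sym _, 4 => some ([], 5)
  | .sym _, _ => none
  | .rend, 1 => some ([], 2)
  | .rend, 3 => some ([.sym .rend], 4)
  | .rend, 5 => some ([.rend], 6)
  | .rend, _ => none

def insRho (q : Fin 7) : Bool := q != 2 && q != 4

theorem ins_fwd (suf : List A) : ∀ pre : List A,
      LRun (LSt insRho (mkT insRho 0 rfl insSt).δ (tapeOf (pre ++ suf)))
        (pre.length + 1, 3) ((suf.map Tape.sym).map Tape.sym) ((pre ++ suf).length + 1, 3) := by
  induction suf with
  | nil => intro pre; simpa using LRun.refl _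
  | cons a suf ih =>
    intro pre
    have ih := ih (pre ++ [a])
    simp only [List.append_assoc, List.singleton_append, List.length_append, List.length_singleton] at ih
    have h1 := (lst_mk (q0 := 0) (h0 := rfl) (st := insSt) (ρ := insRho) (pre.length + 1) _ (tape_sym pre a suf)
        (q := 3) (w := [.sym (.sym a)]) (r := 3) rfl
        (pre.length + 1) (pre.length + 1 + 1) rfl rfl).trans ih
    simpa using h1

theorem good_ins : Good (tapeOf : List A → List (Tape A)) := by
  refine good_mk _ insRho 0 rfl insSt ?_ ?_ ?_ (fun x => x.1) ?_ ?_ ?_ ?_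
  · rintro a q w r w' q' h h'
    rcases a with _ | _ | a <;> fin_cases q <;> fin_cases q' <;> simp [insSt] at h h' ⊢ <;> simp [← h.2] at h'
  · rintro a q w r h
    rcases a with _ | _ | a <;> fin_cases q <;> simp [insSt] at h <;> first | simp [h.1] | simp [← h.1]
  · rintro a q w r h
    fin_cases q <;> simp [insSt] at h <;> first | simp [h.1] | simp [← h.1]
  · intro x y h; simp at h; omega
  · intro x; simp
  · rintro x q r q' r' w w' h h' a b a' b' ea eb ea' eb'
    fin_cases q <;> fin_cases q' <;> simp [insSt] at h h' <;> 
      obtain ⟨-, rfl⟩ := h <;> obtain ⟨-, rfl⟩ := h' <;> simp [insRho] at ea eb ea' eb' <;> omega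
  · intro u
    refine ⟨6, ?_⟩
    have h3 := ins_fwd u []
    rw [List.nil_append] at h3
    have hs : LRun (LSt insRho (mkT insRho 0 rfl insSt).δ (tapeOf u)) (1, 1) [] (1, 2) := by
      cases u with
      | nil => exact lst_mk 1 _ (tape_rend []) rfl _ _ rfl rfl
      | cons a u => exact lst_mk 1 _ (tape_sym [] a u) rfl _ _ rfl rfl
    have he : LRun (LSt insRho (mkT insRho 0 rfl insSt).δ (tapeOf u)) (u.length + 1, 4) [] (u.length + 1, 5) := by
      rcases List.eq_nil_or_concat u with rfl | ⟨u', a, rfl⟩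
      · exact lst_mk 0 _ (tape_lend []) rfl _ _ rfl rfl
      · have := tape_sym u' a []
        exact lst_mk (u'.length + 1) _ (by simpa using this) rfl _ _ (by simp [insRho]) (by simp [insRho])
    have h := (lst_mk (q0 := 0) (h0 := rfl) (st := insSt) (ρ := insRho) 0 _ (tape_lend u)
        (q := 0) (w := [.lend]) (r := 1) rfl 0 1 rfl rfl).trans (hs.trans ((lst_mk 0 _ (tape_lend u)
        (q := 2) (w := [.sym .lend]) (r := 3) rfl 1 1 rfl rfl).trans (h3.trans ((lst_mk (u.length+1) _ (tape_rend u)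
        (q := 3) (w := [.sym .rend]) (r := 4) rfl (u.length + 1) (u.length + 1) rfl rfl).trans (he.trans (lst_mk (u.length+1) _ (tape_rend u)
        (q := 5) (w := [.rend]) (r := 6) rfl (u.length + 1) (u.length + 2) rfl rfl))))))
    simpa [tapeOf] using h

end Ins
end Planar2DFT

namespace Planar2DFT

section Deco

/-- Decorate each letter with the state reached just before it. -/
def deco {S A : Type} (step : S → A → S) : S → List A → List (A × S)
  | _, [] => []
  | s, a :: u => (a, s) :: deco step (step s a) u

theorem good_deco_reset {S A : Type} [Finite S] (act : A → Option S) (s0 : S) :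
    Good (deco (fun s a => (act a).getD s) s0) := by
  refine (good_idr act (fun a s => (a, s)) s0).congr ?_
  intro u
  induction u generalizing s0 with
  | nil => rfl
  | cons a u ih => simp [idr, deco, ih]

/-- Product step. -/
def cstep {S1 S2 A : Type} (step1 : S1 → A → S1) (step2 : S2 → A × S1 → S2) (s : S1 × S2) (a : A) :
    S1 × S2 := (step1 s.1 a, step2 s.2 (a, s.1))

theorem good_cascade {S1 S2 A : Type} (step1 : S1 → A → S1) (step2 : S2 → A × S1 → S2) (s1 : S1) (s2 : S2)
    (h1 : Good (deco step1 s1)) (h2 : Good (deco step2 s2)) :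
    Good (deco (cstep step1 step2) (s1, s2)) := by
  refine ((h1.comp h2).comp (good_map (fun x : (A × S1) × S2 => (x.1.1, (x.1.2, x.2))))).congr ?_
  intro u
  clear h1 h2
  induction u generalizing s1 s2 with
  | nil => rfl
  | cons a u ih => simp [deco, cstep, ih]

theorem deco_hom {S S' A : Type} (step : S → A → S) (step' : S' → A → S') (h : S → S') (I : S → Prop)
    (hI : ∀ s a, I s → I (step s a)) (hh : ∀ s a, I s → h (step s a) = step' (h s) a) (u : List A) :
    ∀ s, I s → (deco step s u).map (fun x => (x.1, h x.2)) = deco step' (h s) u := by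
  induction u with
  | nil => intros; rfl
  | cons a u ih => intro s hs; simp [deco, ih _ (hI s a hs), hh s a hs]

theorem good_hom {S S' A : Type} (step : S → A → S) (step' : S' → A → S') (h : S → S') (I : S → Prop)
    (hI : ∀ s a, I s → I (step s a)) (hh : ∀ s a, I s → h (step s a) = step' (h s) a) (s : S) (hs : I s)
    (hg : Good (deco step s)) : Good (deco step' (h s)) :=
  (hg.comp (good_map (fun x : A × S => (x.1, h x.2)))).congr (fun u => deco_hom step step' h I hI hh u s hs)

/-- Transformation semigroup automaton with resets. -/
def krstep {S A : Type} (act : A → Option (S → S)) (x : S → S) (a : A) : S → S :=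
  match act a with
  | some f => f ∘ x
  | none => id

theorem kr : ∀ n : ℕ, ∀ (S : Type) (_ : Finite S), Nat.card S = n → ∀ P : Set (S → S), id ∈ P →
    (∀ f g, f ∈ P → g ∈ P → f ∘ g ∈ P) → (∃ k : ℕ, ∀ f ∈ P, f^[k+1] = f^[k]) →
    ∀ G : Finset (S → S), (∀ f ∈ G, f ∈ P) → ∀ (A : Type) (act : A → Option (S → S)),
      (∀ a f, act a = some f → f ∈ G ∨ f = id) → Good (deco (krstep act) id) := by
  classical
  intro n
  induction n using Nat.strong_induction_on with
  | _ n IH =>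
  intro S hS hn P hid hmul hap G
  induction G using Finset.strongInduction with
  | _ G ihG =>
  intro hG A act hact
  rcases G.eq_empty_or_nonempty with rfl | ⟨c, hc⟩
  · refine (good_deco_reset (fun a => match act a with | none => some id | some _ => none) (id : S → S)).congr ?_
    intro u
    congr 1
    funext s a
    unfold krstep
    cases ha : act a with
    | none => rfl
    | some f =>
      obtain rfl : f = id := by simpa using hact a f ha
      rfl
  by_cases hcid : c = id
  · refine ihG (G.erase c) (Finset.erase_ssubset hc) (fun f hf => hG f (Finset.mem_of_mem_erase hf)) A act ?_
    intro a f ha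
    rcases hact a f ha with h | h
    · by_cases hfc : f = c
      · exact Or.inr (hfc.trans hcid)
      · exact Or.inl (Finset.mem_erase.2 ⟨hfc, h⟩)
    · exact Or.inr h
  obtain ⟨k, hk⟩ := hap
  have hcP := hG c hc
  have hns : ¬ Function.Surjective c := by
    intro hs
    have hinj := Finite.injective_iff_surjective.2 hs
    apply hcid
    funext s
    have := congrFun (hk c hcP) s
    rw [Function.iterate_succ_apply] at this
    exact hinj.iterate k this
  have hcard : Nat.card (Set.range c) < n := by
    rw [← hn]
    refine lt_of_le_of_ne (Nat.card_le_card_of_injective _ Subtype.val_injective) ?_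
    intro h
    have hb := (Nat.bijective_iff_injective_and_card (Subtype.val : Set.range c → S)).2
      ⟨Subtype.val_injective, h⟩
    apply hns
    intro s
    obtain ⟨⟨t, ht⟩, rfl⟩ := hb.2 s
    exact ht
  let R := Set.range c
  let P' : Set (R → R) := {g | ∃ f ∈ P, ∀ s, ((g s : R) : S) = f s}
  have h1 : Good (deco (krstep (fun a => if act a = some c then none else act a)) (id : S → S)) := by
    refine ihG (G.erase c) (Finset.erase_ssubset hc) (fun f hf => hG f (Finset.mem_of_mem_erase hf)) A _ ?_
    intro a f ha
    split_ifs at ha with hac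
    rcases hact a f ha with h | h
    · left
      refine Finset.mem_erase.2 ⟨?_, h⟩
      rintro rfl
      exact hac ha
    · exact Or.inr h
  have h2 := good_deco_reset (fun z : A × (S → S) => if act z.1 = some c then some true else
    if act z.1 = none then some false else none) false
  let rc (x : S → S) : S → R := fun s => ⟨c (x s), x s, rfl⟩
  have h3 := good_deco_reset (fun z : A × ((S → S) × Bool) => if act z.1 = some c ∧ z.2.2 = false then
    some (rc z.2.1) else none) (rc id)
  let actL : A × (((S → S) × Bool) × (S → R)) → Option (R → R) := fun z =>
    if act z.1 = some c then (if z.2.1.2 = true then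
      (if z.2.1.1 ∈ P then some (fun s => rc z.2.1.1 s.1) else none) else none) else some id
  have h4 : Good (deco (krstep actL) id) := by
    refine IH _ hcard R inferInstance rfl P' ⟨id, hid, fun _ => rfl⟩ ?_ ?_ (Set.toFinite P').toFinset ?_ _ _ ?_
    · rintro f g ⟨f', hf', ef⟩ ⟨g', hg', eg⟩
      exact ⟨f' ∘ g', hmul _ _ hf' hg', fun s => by simp [ef, eg]⟩
    · refine ⟨k, ?_⟩
      rintro f ⟨f', hf', ef⟩
      have hit : ∀ m s, ((f^[m] s : R) : S) = f'^[m] s := by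
        intro m
        induction m with
        | zero => intro s; rfl
        | succ m ih => intro s; rw [Function.iterate_succ_apply, Function.iterate_succ_apply, ih, ef]
      funext s
      apply Subtype.ext
      rw [hit, hit, hk f' hf']
    · intro f hf
      simpa using hf
    · intro a f ha
      simp only [actL] at ha
      split_ifs at ha with ha1 ha2 ha3
      · left
        simp only [Option.some.injEq] at ha
        subst ha
        simp only [Set.Finite.mem_toFinset]
        exact ⟨c ∘ a.2.1.1, hmul _ _ hcP ha3, fun s => rfl⟩
      · right
        simpa using ha.symm
  have H := good_cascade _ _ _ _ (good_cascade _ _ _ _ (good_cascade _ _ _ _ h1 h2) h3) h4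
  refine good_hom _ (krstep act)
    (fun z : (((S → S) × Bool) × (S → R)) × (R → R) =>
      if z.1.1.2 = true then (fun s => z.1.1.1 (z.2 (z.1.2 s)).1) else z.1.1.1)
    (fun z => z.1.1.1 ∈ P) ?_ ?_ _ hid H
  · rintro ⟨⟨⟨x, fl⟩, y⟩, l⟩ a hx
    simp only [cstep, krstep]
    change x ∈ P at hx
    by_cases hac : act a = some c
    · simpa [hac] using hid
    · simp only [hac, if_false]
      cases ha : act a with
      | none => exact hid
      | some f =>
        rcases hact a f ha with h | rfl
        · exact hmul _ _ (hG f h) hx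
        · exact hx
  · rintro ⟨⟨⟨x, fl⟩, y⟩, l⟩ a hx
    change x ∈ P at hx
    simp only [cstep, krstep, actL, rc]
    by_cases hac : act a = some c
    · cases fl
      · simp [hac]
        rfl
      · simp [hac, hx]
        rfl
    · simp only [hac, if_false]
      cases ha : act a with
      | none => simp
      | some f =>
        cases fl
        · simp
        · simp
          rfl

end Deco
end Planar2DFT

namespace Planar2DFT
open Relation

section Prof
variable {Q : Type} (ρ : Q → Bool)

/-- Unlabelled step on a list of cells. -/
def St (W : List (Set (Q × Q))) (c c' : ℕ × Q) : Prop :=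
  ∃ i f, W[i]? = some f ∧ (c.2, c'.2) ∈ f ∧
    c.1 = i + (if ρ c.2 then 0 else 1) ∧ c'.1 = i + (if ρ c'.2 then 1 else 0)

/-- Entry configuration. -/
def In (N : ℕ) (q : Q) : ℕ × Q := (if ρ q then 0 else N, q)

/-- Exit configuration. -/
def Out (N : ℕ) (q : Q) : ℕ × Q := (if ρ q then N else 0, q)

/-- Behaviour of a list of cells. -/
def prof (W : List (Set (Q × Q))) : Set (Q × Q) :=
  {p | ReflTransGen (St ρ W) (In ρ W.length p.1) (Out ρ W.length p.2)}

variable {ρ}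

theorem mem_prof {W : List (Set (Q × Q))} {p r : Q} :
    (p, r) ∈ prof ρ W ↔ ReflTransGen (St ρ W) (In ρ W.length p) (Out ρ W.length r) := Iff.rfl

theorem St.det {W : List (Set (Q × Q))} (hW : ∀ f ∈ W, IsDet f) {c d d' : ℕ × Q}
    (h : St ρ W c d) (h' : St ρ W c d') : d = d' := by
  obtain ⟨i, f, hi, hf, e1, e2⟩ := h
  obtain ⟨i', f', hi', hf', e1', e2'⟩ := h'
  obtain rfl : i = i' := by omega
  rw [hi] at hi'
  obtain rfl : f = f' := by simpa using hi'
  have e := hW f (List.mem_of_getElem? hi) _ _ _ hf hf'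
  rw [← e] at e2'
  exact Prod.ext (by omega) e

theorem Out_term {W : List (Set (Q × Q))} (r : Q) (d : ℕ × Q) : ¬ St ρ W (Out ρ W.length r) d := by
  rintro ⟨i, f, hi, hf, e1, e2⟩
  have := (List.getElem?_eq_some_iff.1 hi).1
  cases h : ρ r <;> simp [Out, h] at e1; omega

theorem prof_det {W : List (Set (Q × Q))} (hW : ∀ f ∈ W, IsDet f) : IsDet (prof ρ W) := by
  intro q r r' h h'
  rw [mem_prof] at h h'
  rcases ReflTransGen.total_of_right_unique (r := St ρ W) (fun _ _ _ => St.det hW) h h' with h1 | h1 <;>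
    rcases ReflTransGen.cases_head h1 with h2 | ⟨d, h2, -⟩
  · exact congrArg Prod.snd h2
  · exact (Out_term _ _ h2).elim
  · exact (congrArg Prod.snd h2).symm
  · exact (Out_term _ _ h2).elim

theorem prof_nil : prof ρ ([] : List (Set (Q × Q))) = idRel Q := by
  ext ⟨p, r⟩
  rw [mem_prof]
  constructor
  · intro h
    rcases ReflTransGen.cases_head h with h2 | ⟨d, ⟨i, f, hi, _⟩, -⟩
    · exact congrArg Prod.snd h2
    · simp at hi
  · intro h
    obtain rfl : p = r := h
    cases h : ρ p <;> simp [In, Out, h] <;> exact .refl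

theorem prof_single (f : Set (Q × Q)) : prof ρ [f] = f := by
  ext ⟨p, r⟩
  rw [mem_prof]
  constructor
  · intro h
    rcases ReflTransGen.cases_head h with h2 | ⟨d, hs, h3⟩
    · have e : p = r := congrArg Prod.snd h2
      subst e
      have := congrArg Prod.fst h2
      cases h : ρ p <;> simp [In, Out, h] at this
    · obtain ⟨i, f', hi, hf, e1, e2⟩ := hs
      obtain ⟨rfl, rfl⟩ : i = 0 ∧ f = f' := by
        cases i <;> simp at hi; exact ⟨rfl, hi⟩
      have hd : d = Out ρ [f].length d.2 := by
        refine Prod.ext ?_ rfl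
        rw [e2]; simp [Out]
      rw [hd] at h3
      rcases ReflTransGen.cases_head h3 with h2 | ⟨d', hs, -⟩
      · have : d.2 = r := congrArg Prod.snd h2
        rw [this] at hf
        exact hf
      · exact (Out_term _ _ hs).elim
  · intro h
    refine .single ⟨0, f, rfl, h, ?_, ?_⟩ <;> simp [In, Out]

theorem St.append_left {u : List (Set (Q × Q))} (v : List (Set (Q × Q))) {c c'} (h : St ρ u c c') :
    St ρ (u ++ v) c c' := by
  obtain ⟨i, f, hi, h⟩ := h
  refine ⟨i, f, ?_, h⟩
  rw [List.getElem?_append_left (List.getElem?_eq_some_iff.1 hi).1, hi]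

theorem St.append_right (u : List (Set (Q × Q))) {v : List (Set (Q × Q))} {c c'} (h : St ρ v c c') :
    St ρ (u ++ v) (u.length + c.1, c.2) (u.length + c'.1, c'.2) := by
  obtain ⟨i, f, hi, hf, e1, e2⟩ := h
  refine ⟨u.length + i, f, ?_, hf, ?_, ?_⟩
  · rw [List.getElem?_append_right (by omega)]; simpa using hi
  · simp only [e1, add_assoc]
  · simp only [e2, add_assoc]

theorem rtg_left {u : List (Set (Q × Q))} (v : List (Set (Q × Q))) {c c'} (h : ReflTransGen (St ρ u) c c') :
    ReflTransGen (St ρ (u ++ v)) c c' := ReflTransGen.mono (fun _ _ => St.append_left v) _ _ h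

theorem rtg_right (u : List (Set (Q × Q))) {v : List (Set (Q × Q))} {c c'} (h : ReflTransGen (St ρ v) c c') :
    ReflTransGen (St ρ (u ++ v)) (u.length + c.1, c.2) (u.length + c'.1, c'.2) :=
  ReflTransGen.lift (fun c : ℕ × Q => (u.length + c.1, c.2)) (fun _ _ => St.append_right u) _ _ h

/-- A step of a concatenation with the head in the left part. -/
theorem St.of_left {u v : List (Set (Q × Q))} {b b' : ℕ} {q r : Q} (h : St ρ (u ++ v) (b, q) (b', r))
    (hb : b ≤ u.length) (hb' : b = u.length → ρ q = false) :
    St ρ u (b, q) (b', r) ∧ b' ≤ u.length := by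
  obtain ⟨i, f, hi, hf, e1, e2⟩ := h
  dsimp only at e1 e2 hf
  have hil : i < u.length := by
    cases hq : ρ q <;> simp [hq] at e1 hb' <;> omega
  rw [List.getElem?_append_left hil] at hi
  refine ⟨⟨i, f, hi, hf, e1, e2⟩, ?_⟩
  split_ifs at e2 <;> omega

theorem St.of_right {u v : List (Set (Q × Q))} {b b' : ℕ} {q r : Q} (h : St ρ (u ++ v) (b, q) (b', r))
    (hb : u.length ≤ b) (hb' : b = u.length → ρ q = true) :
    St ρ v (b - u.length, q) (b' - u.length, r) ∧ u.length ≤ b' := by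
  obtain ⟨i, f, hi, hf, e1, e2⟩ := h
  dsimp only at e1 e2 hf
  have hil : u.length ≤ i := by
    cases hq : ρ q <;> simp [hq] at e1 hb' <;> omega
  rw [List.getElem?_append_right hil] at hi
  refine ⟨⟨i - u.length, f, hi, hf, ?_, ?_⟩, ?_⟩ <;> (try dsimp only) <;> omega

theorem St.fwd_of_max {u : List (Set (Q × Q))} {c : ℕ × Q} {r : Q} (h : St ρ u c (u.length, r)) :
    ρ r = true := by
  obtain ⟨i, f, hi, hf, e1, e2⟩ := h
  have := (List.getElem?_eq_some_iff.1 hi).1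
  by_contra hr
  simp [hr] at e2
  omega

theorem St.bwd_of_zero {u : List (Set (Q × Q))} {c : ℕ × Q} {r : Q} (h : St ρ u c (0, r)) :
    ρ r = false := by
  obtain ⟨i, f, hi, hf, e1, e2⟩ := h
  cases hr : ρ r
  · rfl
  · simp [hr] at e2

theorem glue_left {f g : Set (Q × Q)} {p r : Q} (h : (p, r) ∈ f) :
    GlueEdge ρ f g (p, if ρ p then 0 else 1) (r, if ρ r then 1 else 0) := by
  left
  refine ⟨by split_ifs <;> simp, by split_ifs <;> simp, (p, r), h, ?_, ?_⟩
  · cases hp : ρ p <;> simp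
  · cases hp : ρ r <;> simp

theorem glue_right {f g : Set (Q × Q)} {p r : Q} (h : (p, r) ∈ g) :
    GlueEdge ρ f g (p, if ρ p then 1 else 2) (r, if ρ r then 2 else 1) := by
  right
  refine ⟨by split_ifs <;> simp, by split_ifs <;> simp, (p, r), h, ?_, ?_⟩
  · cases hp : ρ p <;> simp
  · cases hp : ρ r <;> simp

/-- Position of the three levels. -/
def lev (m n : ℕ) (x : Q × Fin 3) : ℕ × Q :=
  (if x.2 = 0 then 0 else if x.2 = 1 then m else m + n, x.1)

theorem glue_sub (u v : List (Set (Q × Q))) {x y} (h : GlueEdge ρ (prof ρ u) (prof ρ v) x y) :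
    ReflTransGen (St ρ (u ++ v)) (lev u.length v.length x) (lev u.length v.length y) := by
  obtain ⟨x, i⟩ := x
  obtain ⟨y, j⟩ := y
  rcases h with ⟨hi, hj, ⟨p, r⟩, hp, e1, e2⟩ | ⟨hi, hj, ⟨p, r⟩, hp, e1, e2⟩
  · have := rtg_left v (mem_prof.1 hp)
    simp only [Prod.mk.injEq] at e1 e2
    obtain ⟨rfl, e1⟩ := e1
    obtain ⟨rfl, e2⟩ := e2
    convert this using 1
    · fin_cases i <;> simp at hi e1 <;> simp [lev, In, e1]
    · fin_cases j <;> simp at hj e2 <;> simp [lev, Out, e2]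
  · have := rtg_right u (mem_prof.1 hp)
    simp only [Prod.mk.injEq] at e1 e2
    obtain ⟨rfl, e1⟩ := e1
    obtain ⟨rfl, e2⟩ := e2
    convert this using 1
    · fin_cases i <;> simp at hi e1 <;> simp [lev, In, e1]
    · fin_cases j <;> simp at hj e2 <;> simp [lev, Out, e2]

theorem prof_append (u v : List (Set (Q × Q))) : prof ρ (u ++ v) = glue ρ (prof ρ u) (prof ρ v) := by
  ext ⟨p, r⟩
  constructor
  · intro h
    rw [mem_prof] at h
    let g0 : Q × Fin 3 := (p, if ρ p then (0 : Fin 3) else 2)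
    let GE := GlueEdge ρ (prof ρ u) (prof ρ v)
    have key : ∀ c, ReflTransGen (St ρ (u ++ v)) (In ρ (u ++ v).length p) c →
        (c.1 ≤ u.length ∧ (c.1 = u.length → ρ c.2 = false) ∧ ∃ p, ReflTransGen GE g0 (p, if ρ p then 0 else 1) ∧
          ReflTransGen (St ρ u) (In ρ u.length p) c) ∨
        (u.length ≤ c.1 ∧ (c.1 = u.length → ρ c.2 = true) ∧ ∃ p, ReflTransGen GE g0 (p, if ρ p then 1 else 2) ∧
          ReflTransGen (St ρ v) (In ρ v.length p) (c.1 - u.length, c.2)) := by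
      intro c hc
      induction hc with
      | refl =>
        cases hp : ρ p
        · by_cases hv : v = []
          · left
            subst hv
            refine ⟨by simp [In, hp], by simp [In, hp], p, .single ?_, ?_⟩
            · have := glue_right (ρ := ρ) (f := prof ρ u) (g := prof ρ []) (p := p) (r := p)
                (by rw [prof_nil]; rfl)
              simpa [GE, g0, hp] using this
            · simpa using ReflTransGen.refl
          · right
            have := List.length_pos_iff.2 hv
            refine ⟨by simp [In, hp], ?_, p, ?_, ?_⟩
            · simp [In, hp, hv]
            · simpa [g0, hp] using ReflTransGen.refl
            · simpa [In, hp] using ReflTransGen.refl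
        · by_cases hv : u = []
          · right
            subst hv
            refine ⟨by simp [In, hp], by simp [In, hp], p, .single ?_, ?_⟩
            · have := glue_left (ρ := ρ) (f := prof ρ []) (g := prof ρ v) (p := p) (r := p)
                (by rw [prof_nil]; rfl)
              simpa [GE, g0, hp] using this
            · simpa using ReflTransGen.refl
          · left
            have := List.length_pos_iff.2 hv
            refine ⟨by simp [In, hp], ?_, p, ?_, ?_⟩
            · simp [In, hp]; exact fun h => hv (List.length_eq_zero_iff.1 h.symm)
            · simpa [g0, hp] using ReflTransGen.refl
            · simpa [In, hp] using ReflTransGen.refl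
      | tail h1 hs ih =>
        rename_i c d
        obtain ⟨b, q⟩ := c
        obtain ⟨b', r⟩ := d
        rcases ih with ⟨hb, hb', p', hg, hr⟩ | ⟨hb, hb', p', hg, hr⟩
        · obtain ⟨hs', hle⟩ := hs.of_left hb hb'
          by_cases he : b' = u.length
          · subst he
            have hρ := hs'.fwd_of_max
            right
            refine ⟨le_rfl, fun _ => hρ, r, hg.tail ?_, ?_⟩
            · have := glue_left (ρ := ρ) (f := prof ρ u) (g := prof ρ v) (p := p') (r := r) ?_
              · simpa [GE, hρ] using this
              · rw [mem_prof]
                have := hr.tail hs'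
                simpa [Out, hρ] using this
            · simpa [In, hρ] using ReflTransGen.refl
          · left
            exact ⟨hle, fun h => (he h).elim, p', hg, hr.tail hs'⟩
        · obtain ⟨hs', hle⟩ := hs.of_right hb hb'
          by_cases he : b' = u.length
          · subst he
            simp only [Nat.sub_self] at hs'
            have hρ := hs'.bwd_of_zero
            left
            refine ⟨le_rfl, fun _ => hρ, r, hg.tail ?_, ?_⟩
            · have := glue_right (ρ := ρ) (f := prof ρ u) (g := prof ρ v) (p := p') (r := r) ?_
              · simpa [GE, hρ] using this
              · rw [mem_prof]
                have := hr.tail hs'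
                simpa [Out, hρ] using this
            · simpa [In, hρ] using ReflTransGen.refl
          · right
            exact ⟨hle, fun h => (he h).elim, p', hg, hr.tail hs'⟩
    rcases key _ h with ⟨hb, hb', p', hg, hr⟩ | ⟨hb, hb', p', hg, hr⟩
    · cases hρ : ρ r
      · simp [Out, hρ] at hr
        have := glue_left (ρ := ρ) (f := prof ρ u) (g := prof ρ v) (p := p') (r := r)
          (by rw [mem_prof]; simpa [Out, hρ] using hr)
        have h2 := hg.tail this
        simpa [glue, hρ] using h2
      · simp [Out, hρ] at hb hb'
        simp [hb] at hb'
    · cases hρ : ρ r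
      · simp [Out, hρ] at hb hb'
        exact (hb' (by simp [hb])).elim
      · simp [Out, hρ] at hr
        have := glue_right (ρ := ρ) (f := prof ρ u) (g := prof ρ v) (p := p') (r := r)
          (by rw [mem_prof]; simpa [Out, hρ] using hr)
        have h2 := hg.tail this
        simpa [glue, hρ] using h2
  · intro h
    have h : ReflTransGen (GlueEdge ρ (prof ρ u) (prof ρ v)) (p, if ρ p then (0 : Fin 3) else 2)
        (r, if ρ r then (2 : Fin 3) else 0) := h
    have := ReflTransGen.lift' (lev u.length v.length) (fun a b => glue_sub u v) _ _ h
    rw [mem_prof]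
    convert this using 1
    · cases hp : ρ p <;> simp [In, lev, hp]
    · cases hp : ρ r <;> simp [Out, lev, hp]

end Prof
end Planar2DFT

namespace Planar2DFT

/-- Iterated concatenation of a word. -/
def wpow {A : Type} (w : List A) (k : ℕ) : List A := (List.replicate k w).flatten

theorem wpow_succ {A : Type} (w : List A) (k : ℕ) : wpow w (k+1) = w ++ wpow w k := by
  simp [wpow, List.replicate_succ]

theorem wpow_succ' {A : Type} (w : List A) (k : ℕ) : wpow w (k+1) = wpow w k ++ w := by
  simp [wpow, List.replicate_succ']

theorem wpow_reverse {A : Type} (w : List A) (k : ℕ) : (wpow w k).reverse = wpow w.reverse k := by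
  induction k with
  | zero => rfl
  | succ k ih => rw [wpow_succ, wpow_succ', List.reverse_append, ih]

theorem good_stepper {V A : Type} [Finite V] (step : V → A → V) (e : V)
    (hap : ∃ k : ℕ, ∀ w0 w : List A, (w0 ++ wpow w (k+1)).foldl step e = (w0 ++ wpow w k).foldl step e)
    (C : Type) (act : C → Option A) :
    Good (deco (fun x c => match act c with | some a => step x a | none => e) e) := by
  classical
  obtain ⟨k, hk⟩ := hap
  let S := {x : V // ∃ w : List A, x = w.foldl step e}
  let F : A → S → S := fun a s => ⟨step s.1 a, by
    obtain ⟨x, w, rfl⟩ := s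
    exact ⟨w ++ [a], by simp⟩⟩
  let e' : S := ⟨e, [], rfl⟩
  let P : Set (S → S) := {f | ∃ w : List A, ∀ s, (f s).1 = w.foldl step s.1}
  have hFP : ∀ a, F a ∈ P := fun a => ⟨[a], fun s => rfl⟩
  have h := kr _ S inferInstance rfl P ⟨[], fun s => rfl⟩ ?_ ⟨k, ?_⟩ (Set.toFinite P).toFinset ?_ C
    (fun c => (act c).map F) ?_
  · refine good_hom _ (fun x c => match act c with | some a => step x a | none => e)
      (fun f => (f e').1) (fun _ => True) (fun _ _ _ => trivial) ?_ _ trivial h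
    intro f c _
    cases hc : act c <;> simp [krstep, hc, e', F]
  · rintro f g ⟨w, hw⟩ ⟨w', hw'⟩
    exact ⟨w' ++ w, fun s => by simp [hw, hw']⟩
  · rintro f ⟨w, hw⟩
    have hit : ∀ m s, (f^[m] s).1 = (wpow w m).foldl step s.1 := by
      intro m
      induction m with
      | zero => intro s; rfl
      | succ m ih => intro s; rw [Function.iterate_succ_apply, ih, hw, wpow_succ, List.foldl_append]
    funext s
    apply Subtype.ext
    rw [hit, hit]
    obtain ⟨x, w0, rfl⟩ := s
    have := hk w0 w
    rwa [List.foldl_append, List.foldl_append] at this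
  · intro f hf
    simpa using hf
  · intro c f hc
    left
    simp only [Option.map_eq_some_iff] at hc
    obtain ⟨a, -, rfl⟩ := hc
    simpa using hFP a

section
variable {Q A B : Type} (T : TwoWayTransducer Q A B)

/-- Profile of an input word. -/
def pw (w : List A) : Set (Q × Q) := prof T.ρ (w.map (fun a => T.rel (Tape.sym a)))

variable {T}

theorem pw_append (u v : List A) : pw T (u ++ v) = glue T.ρ (pw T u) (pw T v) := by
  simp [pw, prof_append]

theorem pw_single (a : A) : pw T [a] = T.rel (Tape.sym a) := by
  simp [pw, prof_single]

theorem pw_nil : pw T [] = idRel Q := by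
  simp [pw, prof_nil]

theorem pw_behav (w : List A) : InBehav T (pw T w) := by
  induction w with
  | nil => rw [pw_nil]; exact .one
  | cons a w ih =>
    rw [← List.singleton_append, pw_append, pw_single]
    exact .mul (.gen a) ih

theorem pw_pow (w : List A) (k : ℕ) : pw T (wpow w k) = glpow T.ρ (pw T w) k := by
  induction k with
  | zero => exact pw_nil
  | succ k ih => rw [wpow_succ', pw_append, ih]; rfl

theorem pw_ap (h : ApBehav T) : ∃ k, ∀ w : List A, pw T (wpow w (k+1)) = pw T (wpow w k) := by
  obtain ⟨k, h⟩ := h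
  exact ⟨k, fun w => by rw [pw_pow, pw_pow, h _ (pw_behav w)]⟩

theorem foldl_pw (w w0 : List A) :
    w.foldl (fun x a => glue T.ρ x (T.rel (Tape.sym a))) (pw T w0) = pw T (w0 ++ w) := by
  induction w generalizing w0 with
  | nil => simp
  | cons a w ih => rw [List.foldl_cons, ← pw_single, ← pw_append, ih]; simp

theorem foldl_pw' (w w0 : List A) :
    w.foldl (fun x a => glue T.ρ (T.rel (Tape.sym a)) x) (pw T w0) = pw T (w.reverse ++ w0) := by
  induction w generalizing w0 with
  | nil => simp
  | cons a w ih => rw [List.foldl_cons, ← pw_single, ← pw_append, ih]; simp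

variable (T)
/-- Prefix stepping. -/
def stepP (x : Set (Q × Q)) (t : Tape A) : Set (Q × Q) :=
  match t with
  | .sym a => glue T.ρ x (T.rel (Tape.sym a))
  | _ => idRel Q

/-- Suffix stepping. -/
def stepS (x : Set (Q × Q)) (t : Tape A) : Set (Q × Q) :=
  match t with
  | .sym a => glue T.ρ (T.rel (Tape.sym a)) x
  | _ => idRel Q

/-- Decorated input. -/
def bideco (u : List A) : List ((Tape A × Set (Q × Q)) × Set (Q × Q)) :=
  (deco (fun x (z : Tape A × Set (Q × Q)) => stepS T x z.1) (idRel Q)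
    (deco (stepP T) (idRel Q) (tapeOf u)).reverse).reverse

def tsym : Tape A → Option A
  | .sym a => some a
  | _ => none

theorem good_bideco [Finite Q] (h : ApBehav T) : Good (bideco T) := by
  obtain ⟨k, hk⟩ := pw_ap h
  have h1 : Good (deco (stepP T) (idRel Q)) := by
    have := good_stepper (fun x a => glue T.ρ x (T.rel (Tape.sym a))) (idRel Q) ⟨k, ?_⟩ (Tape A) tsym
    · convert this using 3 with x
      funext t
      cases t <;> rfl
    · intro w0 w
      rw [← pw_nil (T := T), foldl_pw, foldl_pw]
      simp [pw_append, hk]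
  have h2 : Good (deco (fun x (z : Tape A × Set (Q × Q)) => stepS T x z.1) (idRel Q)) := by
    have := good_stepper (fun x a => glue T.ρ (T.rel (Tape.sym a)) x) (idRel Q) ⟨k, ?_⟩
      (Tape A × Set (Q × Q)) (fun z => tsym z.1)
    · convert this using 3 with x
      funext t
      rcases t with ⟨t, _⟩
      cases t <;> rfl
    · intro w0 w
      rw [← pw_nil (T := T), foldl_pw', foldl_pw']
      simp only [List.reverse_append, wpow_reverse]
      simp [pw_append, hk]
  exact ((((good_ins.comp h1).comp good_reverse).comp h2).comp good_reverse)

theorem deco_get {S C : Type} (step : S → C → S) (s : S) (L : List C) (i : ℕ) :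
    (deco step s L)[i]? = (L[i]?).map (fun a => (a, (L.take i).foldl step s)) := by
  induction L generalizing s i with
  | nil => simp [deco]
  | cons a L ih =>
    cases i with
    | zero => simp [deco]
    | succ i => simp [deco, ih]

theorem deco_length {S C : Type} (step : S → C → S) (s : S) (L : List C) :
    (deco step s L).length = L.length := by
  induction L generalizing s with
  | nil => simp [deco]
  | cons a L ih => simp [deco, ih]

theorem deco_fst {S C : Type} (step : S → C → S) (s : S) (L : List C) :
    (deco step s L).map Prod.fst = L := by
  induction L generalizing s with
  | nil => simp [deco]
  | cons a L ih => simp [deco, ih]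

theorem bideco_length (u : List A) : (bideco T u).length = u.length + 2 := by
  simp [bideco, deco_length, tapeOf_length]

theorem bideco_get (u : List A) (i : ℕ) (t : Tape A) (ht : (tapeOf u)[i]? = some t) :
    (bideco T u)[i]? = some ((t, ((tapeOf u).take i).foldl (stepP T) (idRel Q)),
      ((tapeOf u).drop (i+1)).reverse.foldl (stepS T) (idRel Q)) := by
  have hi := (List.getElem?_eq_some_iff.1 ht).1
  have hl := tapeOf_length u
  unfold bideco
  rw [List.getElem?_reverse (by simpa [deco_length] using hi)]
  rw [deco_get]
  rw [List.getElem?_reverse (by simp [deco_length]; omega)]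
  simp only [deco_length, List.length_reverse]
  have e1 : (tapeOf u).length - 1 - ((tapeOf u).length - 1 - i) = i := by omega
  rw [e1, deco_get, ht]
  simp only [Option.map_some]
  congr 2
  rw [List.take_reverse]
  have e2 : (deco (stepP T) (idRel Q) (tapeOf u)).length - ((tapeOf u).length - 1 - i) = i + 1 := by
    rw [deco_length]; omega
  rw [e2]
  conv_rhs => rw [← deco_fst (stepP T) (idRel Q) (tapeOf u)]
  rw [← List.map_drop, ← List.map_reverse, List.foldl_map]

/-- Prefix behaviour from the decoration. -/
def Xof (z : (Tape A × Set (Q × Q)) × Set (Q × Q)) : Set (Q × Q) :=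
  match z.1.1 with
  | .lend => idRel Q
  | _ => glue T.ρ (T.rel .lend) z.1.2

/-- Suffix behaviour from the decoration. -/
def Yof (z : (Tape A × Set (Q × Q)) × Set (Q × Q)) : Set (Q × Q) :=
  match z.1.1 with
  | .rend => idRel Q
  | _ => glue T.ρ z.2 (T.rel .rend)

theorem foldl_stepP (w : List A) : (w.map Tape.sym).foldl (stepP T) (idRel Q) = pw T w := by
  rw [List.foldl_map]
  have := foldl_pw (T := T) w []
  rw [pw_nil] at this
  simpa [stepP] using this

theorem foldl_stepS (w : List A) : (w.map Tape.sym).foldl (stepS T) (idRel Q) = pw T w.reverse := by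
  rw [List.foldl_map]
  have := foldl_pw' (T := T) w []
  rw [pw_nil] at this
  simpa [stepS] using this

theorem Xof_eq (u : List A) (i : ℕ) (t : Tape A) (ht : (tapeOf u)[i]? = some t) (y) :
    Xof T ((t, ((tapeOf u).take i).foldl (stepP T) (idRel Q)), y) = prof T.ρ (((tapeOf u).take i).map T.rel) := by
  have hi := (List.getElem?_eq_some_iff.1 ht).1
  rw [tapeOf_length] at hi
  cases i with
  | zero =>
    obtain rfl : Tape.lend = t := by simpa [tapeOf] using ht
    simp [Xof, prof_nil]
  | succ j =>
    have hX : ∀ x y, Xof T ((t, x), y) = glue T.ρ (T.rel .lend) x := by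
      intro x y
      cases t
      · simp only [tapeOf, List.getElem?_cons_succ] at ht
        have := List.mem_of_getElem? ht
        simp at this
      · rfl
      · rfl
    have htk : (tapeOf u).take (j+1) = Tape.lend :: (u.take j).map Tape.sym := by
      simp only [tapeOf, List.take_succ_cons]
      rw [List.take_append_of_le_length (by simp; omega), List.map_take]
    rw [hX, htk, List.foldl_cons]
    have : stepP T (idRel Q) Tape.lend = idRel Q := rfl
    rw [this, foldl_stepP, List.map_cons, ← List.singleton_append, prof_append, prof_single]
    simp [pw, Function.comp_def]

theorem Yof_eq (u : List A) (i : ℕ) (t : Tape A) (ht : (tapeOf u)[i]? = some t) (x) :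
    Yof T ((t, x), ((tapeOf u).drop (i+1)).reverse.foldl (stepS T) (idRel Q)) =
      prof T.ρ (((tapeOf u).drop (i+1)).map T.rel) := by
  have hi := (List.getElem?_eq_some_iff.1 ht).1
  rw [tapeOf_length] at hi
  by_cases hlast : i = u.length + 1
  · subst hlast
    obtain rfl : Tape.rend = t := by rw [tape_rend] at ht; simpa using ht
    rw [List.drop_of_length_le (by rw [tapeOf_length])]
    simp [Yof, prof_nil]
  · have hX : ∀ x y, Yof T ((t, x), y) = glue T.ρ y (T.rel .rend) := by
      intro x y
      cases t
      · rfl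
      · exfalso
        cases i with
        | zero => simp [tapeOf] at ht
        | succ j =>
          simp only [tapeOf, List.getElem?_cons_succ] at ht
          rw [List.getElem?_append_left (by simp; omega)] at ht
          simp at ht
      · rfl
    have htk : (tapeOf u).drop (i+1) = (u.drop i).map Tape.sym ++ [Tape.rend] := by
      simp only [tapeOf, List.drop_succ_cons]
      rw [List.drop_append_of_le_length (by simp; omega), List.map_drop]
    rw [hX, htk, List.reverse_append, List.reverse_singleton, List.singleton_append, List.foldl_cons]
    have : stepS T (idRel Q) Tape.rend = idRel Q := rfl
    rw [this, ← List.map_reverse, foldl_stepS, List.map_append, prof_append, List.reverse_reverse]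
    simp [pw, Function.comp_def, prof_single]

end
end Planar2DFT

namespace Planar2DFT
open Relation

section Trace
variable {Q : Type} (ρ : Q → Bool)

/-- Timed traces with visit counters for each boundary. -/
inductive Tr (W : List (Set (Q × Q))) (q0 : Q) : ℕ → (ℕ → ℕ) → ℕ × Q → Prop
  | zero : Tr W q0 0 (fun b => if b = 0 then 1 else 0) (0, q0)
  | succ {τ K c c'} : Tr W q0 τ K c → St ρ W c c' →
      Tr W q0 (τ + 1) (fun b => if b = c'.1 then K b + 1 else K b) c'

def Acc (W : List (Set (Q × Q))) (q0 : Q) : Prop :=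
  ∃ τ K e, Tr ρ W q0 τ K (W.length, e) ∧ ρ e = true

variable {ρ} {W : List (Set (Q × Q))} {q0 : Q}

theorem Tr.func (hW : ∀ f ∈ W, IsDet f) {τ K c K' c'} (h : Tr ρ W q0 τ K c) (h' : Tr ρ W q0 τ K' c') :
    K = K' ∧ c = c' := by
  induction h generalizing K' c' with
  | zero => cases h'; exact ⟨rfl, rfl⟩
  | succ h1 h2 ih =>
    cases h' with
    | succ h1' h2' =>
      obtain ⟨rfl, rfl⟩ := ih h1'
      obtain rfl := St.det hW h2 h2'
      exact ⟨rfl, rfl⟩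

theorem Tr.prev {τ K c} (h : Tr ρ W q0 τ K c) : ∀ s < τ, ∃ K' c' c'', Tr ρ W q0 s K' c' ∧ St ρ W c' c'' := by
  induction h with
  | zero => intro s hs; omega
  | succ h1 h2 ih =>
    rename_i τ' K c c'
    intro s hs
    rcases Nat.lt_succ_iff_lt_or_eq.1 hs with h | rfl
    · exact ih s h
    · exact ⟨_, _, _, h1, h2⟩

theorem Tr.mono (hW : ∀ f ∈ W, IsDet f) {τ' K' c'} (h : Tr ρ W q0 τ' K' c') : ∀ τ K c, τ < τ' → Tr ρ W q0 τ K c →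
    (∀ b, K b ≤ K' b) ∧ K c'.1 < K' c'.1 := by
  induction h with
  | zero => intro τ K c h; omega
  | succ h1 h2 ih =>
    intro τ K c hτ hK
    rename_i τ1 K1 c1 c2
    have hle : ∀ b, K b ≤ K1 b := by
      rcases Nat.lt_succ_iff_lt_or_eq.1 hτ with h | rfl
      · exact (ih τ K c h hK).1
      · obtain ⟨rfl, rfl⟩ := Tr.func hW hK h1
        exact fun b => le_rfl
    constructor
    · intro b
      have := hle b
      dsimp only
      split_ifs <;> omega
    · have := hle c2.1
      simp
      omega

theorem Tr.last (hW : ∀ f ∈ W, IsDet f) {m K e} (h : Tr ρ W q0 m K e) (he : ∀ d, ¬ St ρ W e d)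
    {τ K' c} (h' : Tr ρ W q0 τ K' c) : τ ≤ m := by
  by_contra hlt
  obtain ⟨K1, c1, c2, h1, h2⟩ := h'.prev m (by omega)
  obtain ⟨rfl, rfl⟩ := Tr.func hW h h1
  exact he _ h2

theorem Tr.shift (hW : ∀ f ∈ W, IsDet f) {τ τ' K K' c} (h : Tr ρ W q0 τ K c) (h' : Tr ρ W q0 τ' K' c) (d : ℕ) :
    ∀ K1 x, Tr ρ W q0 (τ + d) K1 x → ∃ K2, Tr ρ W q0 (τ' + d) K2 x := by
  induction d with
  | zero =>
    intro K1 x h1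
    obtain ⟨rfl, rfl⟩ := Tr.func hW h h1
    exact ⟨_, h'⟩
  | succ d ih =>
    intro K1 x h1
    cases h1 with
    | succ h1 h2 =>
      obtain ⟨K2, h3⟩ := ih _ _ h1
      exact ⟨_, .succ h3 h2⟩

theorem Tr.uniq_aux (hW : ∀ f ∈ W, IsDet f) {m K e} (h : Tr ρ W q0 m K e) (he : ∀ d, ¬ St ρ W e d)
    {τ τ' K' K'' c} (h' : Tr ρ W q0 τ K' c) (h'' : Tr ρ W q0 τ' K'' c) : ¬ τ < τ' := by
  intro hlt
  have h1 := h.last hW he h'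
  obtain ⟨d, rfl⟩ := Nat.exists_eq_add_of_le h1
  obtain ⟨K2, h2⟩ := Tr.shift hW h' h'' d _ _ h
  have := h.last hW he h2
  omega

theorem Acc.uniq (hA : Acc ρ W q0) (hW : ∀ f ∈ W, IsDet f) {τ τ' K' K'' c}
    (h' : Tr ρ W q0 τ K' c) (h'' : Tr ρ W q0 τ' K'' c) : τ = τ' ∧ K' = K'' := by
  obtain ⟨m, K, e, h, he⟩ := hA
  have hterm : ∀ d, ¬ St ρ W (W.length, e) d := by
    intro d hd
    have : (W.length, e) = Out ρ W.length e := by simp [Out, he]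
    rw [this] at hd
    exact Out_term _ _ hd
  have h1 := Tr.uniq_aux hW h hterm h' h''
  have h2 := Tr.uniq_aux hW h hterm h'' h'
  obtain rfl : τ = τ' := by omega
  exact ⟨rfl, (Tr.func hW h' h'').1⟩

theorem Tr.visits {τ K c} (h : Tr ρ W q0 τ K c) (b : ℕ) : ∀ j, 1 ≤ j → j ≤ K b →
    ∃ τ' K' q, Tr ρ W q0 τ' K' (b, q) ∧ K' b = j := by
  induction h with
  | zero =>
    intro j h1 h2
    by_cases hb : b = 0
    · subst hb
      simp at h2
      exact ⟨0, _, q0, .zero, by simp; omega⟩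
    · simp [hb] at h2; omega
  | succ h1 h2 ih =>
    rename_i τ1 K1 c1 c2
    intro j hj1 hj2
    by_cases hj : j ≤ K1 b
    · exact ih j hj1 hj
    · by_cases hb : b = c2.1
      · subst hb
        simp at hj2
        exact ⟨_, _, c2.2, .succ h1 h2, by simp; omega⟩
      · simp [hb] at hj2; omega

theorem Acc.bound [Finite Q] (hA : Acc ρ W q0) (hW : ∀ f ∈ W, IsDet f) {τ K c} (h : Tr ρ W q0 τ K c) (b : ℕ) :
    K b ≤ Nat.card Q := by
  have hv : ∀ j : Fin (K b), ∃ τ' K' q, Tr ρ W q0 τ' K' (b, q) ∧ K' b = j.1 + 1 := fun j =>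
    h.visits b (j.1 + 1) (by omega) (by omega)
  choose t k q hq hk using hv
  have hinj : Function.Injective q := by
    intro i j hij
    have hi := hq i
    rw [hij] at hi
    have := (hA.uniq hW hi (hq j)).2
    have h1 := hk i
    have h2 := hk j
    rw [this] at h1
    apply Fin.ext
    omega
  simpa using Nat.card_le_card_of_injective q hinj

theorem proj (L M : List (Set (Q × Q))) (f : Set (Q × Q)) (h0 : ρ q0 = true) {τ K c}
    (h : Tr ρ (L ++ f :: M) q0 τ K c) :
    ∃ p τ' K', K' 1 = K L.length ∧ K' 2 = K (L.length + 1) ∧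
    ((c.1 ≤ L.length ∧ (c.1 = L.length → ρ c.2 = false) ∧
        Tr ρ [prof ρ L, f, prof ρ M] q0 τ' K' (if ρ p then 0 else 1, p) ∧
        ReflTransGen (St ρ L) (In ρ L.length p) c) ∨
     (c = (L.length, p) ∧ ρ p = true ∧ Tr ρ [prof ρ L, f, prof ρ M] q0 τ' K' (1, p)) ∨
     (c = (L.length + 1, p) ∧ ρ p = false ∧ Tr ρ [prof ρ L, f, prof ρ M] q0 τ' K' (2, p)) ∨
     (L.length + 1 ≤ c.1 ∧ (c.1 = L.length + 1 → ρ c.2 = true) ∧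
        Tr ρ [prof ρ L, f, prof ρ M] q0 τ' K' (if ρ p then 2 else 3, p) ∧
        ReflTransGen (St ρ M) (In ρ M.length p) (c.1 - (L.length + 1), c.2))) := by
  induction h with
  | zero =>
    by_cases hL : L = []
    · subst hL
      have ht : Tr ρ [prof ρ [], f, prof ρ M] q0 (0 + 1) _ (1, q0) := Tr.succ .zero
        ⟨0, _, rfl, (by rw [prof_nil]; rfl : (q0, q0) ∈ prof ρ []), by simp [h0], by simp [h0]⟩
      exact ⟨q0, _, _, by simp, by simp, Or.inr (Or.inl ⟨rfl, h0, ht⟩)⟩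
    · have := List.length_pos_iff.2 hL
      refine ⟨q0, 0, (fun b => if b = 0 then 1 else 0), ?_, ?_, Or.inl ⟨by simp, ?_, ?_, ?_⟩⟩
      · simp [hL]
      · simp
      · intro h; dsimp only at h; omega
      · simp only [h0, if_true]; exact .zero
      · simpa [In, h0] using ReflTransGen.refl
  | succ h1 h2 ih =>
    rename_i τ1 K1 c d
    obtain ⟨b, q⟩ := c
    obtain ⟨b', r⟩ := d
    obtain ⟨p, τ', K', k1, k2, ih⟩ := ih
    -- the middle step
    have mid : ∀ s : ℕ, ((b = L.length ∧ ρ q = true ∧ s = 1) ∨ (b = L.length + 1 ∧ ρ q = false ∧ s = 2)) →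
        Tr ρ [prof ρ L, f, prof ρ M] q0 τ' K' (s, q) →
        (b' = L.length + if ρ r then 1 else 0) ∧
        Tr ρ [prof ρ L, f, prof ρ M] q0 (τ' + 1) (fun b => if b = 1 + (if ρ r then 1 else 0) then K' b + 1 else K' b)
          (1 + (if ρ r then 1 else 0), r) := by
      intro s hs ht
      obtain ⟨i, g, hi, hf, e1, e2⟩ := h2
      dsimp only at hf e1 e2
      obtain rfl : i = L.length := by
        rcases hs with ⟨h, h', -⟩ | ⟨h, h', -⟩ <;> simp [h'] at e1 <;> omega
      obtain rfl : f = g := by simpa using hi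
      refine ⟨e2, Tr.succ (c' := (1 + (if ρ r then 1 else 0), r)) ht ⟨1, f, rfl, hf, ?_, rfl⟩⟩
      rcases hs with ⟨h, h', rfl⟩ | ⟨h, h', rfl⟩ <;> simp [h']
    have mid2 : ∀ s : ℕ, ((b = L.length ∧ ρ q = true ∧ s = 1) ∨ (b = L.length + 1 ∧ ρ q = false ∧ s = 2)) →
        Tr ρ [prof ρ L, f, prof ρ M] q0 τ' K' (s, q) → _ := fun s hs ht => by
      obtain ⟨eb, ht'⟩ := mid s hs ht
      refine (⟨r, τ' + 1, (fun b => if b = 1 + (if ρ r then 1 else 0) then K' b + 1 else K' b), ?_, ?_, ?_⟩ : ∃ p τ'' K'', K'' 1 = (if L.length = b' then K1 L.length + 1 else K1 L.length) ∧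
        K'' 2 = (if L.length + 1 = b' then K1 (L.length + 1) + 1 else K1 (L.length + 1)) ∧
      ((b' ≤ L.length ∧ (b' = L.length → ρ r = false) ∧
        Tr ρ [prof ρ L, f, prof ρ M] q0 τ'' K'' (if ρ p then 0 else 1, p) ∧
        ReflTransGen (St ρ L) (In ρ L.length p) (b', r)) ∨
      (L.length + 1 ≤ b' ∧ (b' = L.length + 1 → ρ r = true) ∧
        Tr ρ [prof ρ L, f, prof ρ M] q0 τ'' K'' (if ρ p then 2 else 3, p) ∧
        ReflTransGen (St ρ M) (In ρ M.length p) (b' - (L.length + 1), r))))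
      rotate_left 2
      · cases hr : ρ r
        · left
          simp [hr] at eb ht'
          subst eb
          refine ⟨le_rfl, fun _ => rfl, by simpa using ht', by simpa [In, hr] using ReflTransGen.refl⟩
        · right
          simp [hr] at eb ht'
          subst eb
          refine ⟨le_rfl, fun _ => rfl, by simpa using ht', by simpa [In, hr] using ReflTransGen.refl⟩
      · cases hr : ρ r <;> simp [hr] at eb ⊢ <;> simp [eb, k1]
      · cases hr : ρ r <;> simp [hr] at eb ⊢ <;> simp [eb, k2]
    rcases ih with ⟨hb, hb', ht, hr⟩ | ⟨e, hp, ht⟩ | ⟨e, hp, ht⟩ | ⟨hb, hb', ht, hr⟩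
    · obtain ⟨hs', hle⟩ := h2.of_left hb hb'
      by_cases he : b' = L.length
      · subst he
        have hρ := hs'.fwd_of_max
        have hm : (p, r) ∈ prof ρ L := by
          rw [mem_prof]
          have := hr.tail hs'
          simpa [Out, hρ] using this
        have ht' := Tr.succ ht (c' := (1, r)) ⟨0, _, rfl, hm, by simp, by simp [hρ]⟩
        exact ⟨r, _, _, by simp [k1], by simp [k2], Or.inr (Or.inl ⟨rfl, hρ, ht'⟩)⟩
      · refine ⟨p, _, _, ?_, ?_, Or.inl ⟨hle, fun h => (he h).elim, ht, hr.tail hs'⟩⟩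
        · simp [k1, Ne.symm he]
        · have : L.length + 1 ≠ b' := by omega
          simp [k2, this]
    · obtain ⟨rfl, rfl⟩ : b = L.length ∧ q = p := by simpa using e
      obtain ⟨p', t', K'', e1, e2, h⟩ := mid2 1 (Or.inl ⟨rfl, hp, rfl⟩) ht
      refine ⟨p', t', K'', e1, e2, ?_⟩
      rcases h with h | h
      · exact Or.inl h
      · exact Or.inr (Or.inr (Or.inr h))
    · obtain ⟨rfl, rfl⟩ : b = L.length + 1 ∧ q = p := by simpa using e
      obtain ⟨p', t', K'', e1, e2, h⟩ := mid2 2 (Or.inr ⟨rfl, hp, rfl⟩) ht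
      refine ⟨p', t', K'', e1, e2, ?_⟩
      rcases h with h | h
      · exact Or.inl h
      · exact Or.inr (Or.inr (Or.inr h))
    · have hW : L ++ f :: M = (L ++ [f]) ++ M := by simp
      have hl : (L ++ [f]).length = L.length + 1 := by simp
      rw [hW] at h2
      rw [← hl] at hb hb'
      obtain ⟨hs', hle⟩ := h2.of_right hb hb'
      rw [hl] at hs' hle
      by_cases he : b' = L.length + 1
      · subst he
        simp only [Nat.sub_self] at hs'
        have hρ := hs'.bwd_of_zero
        have hm : (p, r) ∈ prof ρ M := by
          rw [mem_prof]
          have := hr.tail hs'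
          simpa [Out, hρ] using this
        have ht' := Tr.succ ht (c' := (2, r)) ⟨2, _, rfl, hm, by dsimp only; split_ifs <;> rfl, by simp [hρ]⟩
        exact ⟨r, _, _, by simp [k1], by simp [k2], Or.inr (Or.inr (Or.inl ⟨rfl, hρ, ht'⟩))⟩
      · refine ⟨p, _, _, ?_, ?_, Or.inr (Or.inr (Or.inr ⟨hle, fun h => (he h).elim, ht, hr.tail hs'⟩))⟩
        · have : L.length ≠ b' := by omega
          simp [k1, this]
        · simp [k2, Ne.symm he]

theorem proj_acc (L M : List (Set (Q × Q))) (f : Set (Q × Q)) (h0 : ρ q0 = true)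
    (h : Acc ρ (L ++ f :: M) q0) : Acc ρ [prof ρ L, f, prof ρ M] q0 := by
  obtain ⟨τ, K, e, h, he⟩ := h
  obtain ⟨p, τ', K', k1, k2, ih⟩ := proj L M f h0 h
  rcases ih with ⟨hb, hb', ht, hr⟩ | ⟨e, hp, ht⟩ | ⟨e, hp, ht⟩ | ⟨hb, hb', ht, hr⟩
  · simp at hb
  · simp at e
  · simp at e
    obtain ⟨-, rfl⟩ := e
    rw [he] at hp; simp at hp
  · have hm : (p, e) ∈ prof ρ M := by
      rw [mem_prof]
      have : L.length + (M.length + 1) - (L.length + 1) = M.length := by omega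
      simpa [Out, he, this] using hr
    refine ⟨_, _, e, Tr.succ ht (c' := (3, e)) ⟨2, _, rfl, hm, by dsimp only; split_ifs <;> rfl, by simp [he]⟩, he⟩

end Trace
end Planar2DFT

namespace Planar2DFT
open Relation

section ProjIn
variable {Q : Type} {ρ : Q → Bool} {q0 : Q}

theorem proj_in (L M : List (Set (Q × Q))) (f : Set (Q × Q)) (h0 : ρ q0 = true) {τ K q}
    (h : Tr ρ (L ++ f :: M) q0 τ K (L.length + (if ρ q then 0 else 1), q)) :
    ∃ τ' K', Tr ρ [prof ρ L, f, prof ρ M] q0 τ' K' (1 + (if ρ q then 0 else 1), q) ∧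
      K' 1 = K L.length ∧ K' 2 = K (L.length + 1) := by
  obtain ⟨p, τ', K', k1, k2, ih⟩ := proj L M f h0 h
  refine ⟨τ', K', ?_, k1, k2⟩
  rcases ih with ⟨hb, hb', -, -⟩ | ⟨e, hp, ht⟩ | ⟨e, hp, ht⟩ | ⟨hb, hb', -, -⟩
  · cases hq : ρ q <;> simp [hq] at hb hb'
  · obtain ⟨e1, rfl⟩ := Prod.mk.inj e
    simpa [hp] using ht
  · obtain ⟨e1, rfl⟩ := Prod.mk.inj e
    simpa [hp] using ht
  · cases hq : ρ q <;> simp [hq] at hb hb'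

end ProjIn

section Final
variable {n : ℕ} {A B : Type} (T : TwoWayTransducer (Fin n) A B)

/-- Three-cell abstraction of the tape around a decorated letter. -/
def coarse (z : (Tape A × Set (Fin n × Fin n)) × Set (Fin n × Fin n)) : List (Set (Fin n × Fin n)) :=
  [Xof T z, T.rel z.1.1, Yof T z]

/-- Edges of the final machine over a decorated letter. -/
def Fedge (z : (Tape A × Set (Fin n × Fin n)) × Set (Fin n × Fin n)) :
    Set ((Fin (n + 1) × Fin n) × List B × (Fin (n + 1) × Fin n)) :=
  {e | (∀ f ∈ coarse T z, IsDet f) ∧ Acc T.ρ (coarse T z) T.init ∧ (e.1.2, e.2.1, e.2.2.2) ∈ T.δ z.1.1 ∧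
    ∃ τ K K', Tr T.ρ (coarse T z) T.init τ K (1 + (if T.ρ e.1.2 then 0 else 1), e.1.2) ∧
      Tr T.ρ (coarse T z) T.init (τ + 1) K' (1 + (if T.ρ e.2.2.2 then 1 else 0), e.2.2.2) ∧
      K (1 + (if T.ρ e.1.2 then 0 else 1)) = e.1.1.1 ∧
      K' (1 + (if T.ρ e.2.2.2 then 1 else 0)) = e.2.2.1.1}

/-- Initial state of the final machine. -/
def Finit : Fin (n + 1) × Fin n := (⟨1, by have := T.init.2; omega⟩, T.init)

/-- The final machine. -/
def FM : TwoWayTransducer (Fin (n + 1) × Fin n) ((Tape A × Set (Fin n × Fin n)) × Set (Fin n × Fin n)) B where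
  ρ s := T.ρ s.2
  init := Finit T
  init_fwd := T.init_fwd
  final := {s | s.2 ∈ T.final}
  δ t := match t with
    | .lend => {(Finit T, [], Finit T)}
    | .rend => {e | e.1 = e.2.2 ∧ e.2.1 = [] ∧ T.ρ e.1.2 = true}
    | .sym z => Fedge T z

theorem FM_rev : (FM T).Reversible := by
  intro a
  cases a with
  | lend =>
    constructor
    · rintro q r r' ⟨w, h⟩ ⟨w', h'⟩
      simp [FM] at h h'
      rw [h.2.2, h'.2.2]
    · rintro q r r' ⟨w, h⟩ ⟨w', h'⟩
      simp [FM] at h h'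
      rw [h.1, h'.1]
  | rend =>
    constructor
    · rintro q r r' ⟨w, h⟩ ⟨w', h'⟩
      simp [FM] at h h'
      rw [← h.1, ← h'.1]
    · rintro q r r' ⟨w, h⟩ ⟨w', h'⟩
      simp [FM] at h h'
      rw [h.1, h'.1]
  | sym z =>
    constructor
    · rintro ⟨j, q⟩ ⟨k, r⟩ ⟨k', r'⟩ ⟨w, hW, hA, -, τ, K, K', h1, h2, h3, h4⟩ ⟨w', -, -, -, τ', L, L', h1', h2', h3', h4'⟩
      dsimp only at *
      obtain ⟨rfl, rfl⟩ := hA.uniq hW h1 h1'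
      obtain ⟨rfl, e⟩ := Tr.func hW h2 h2'
      obtain ⟨-, rfl⟩ := Prod.mk.inj e
      rw [h4] at h4'
      rw [Fin.ext h4']
    · rintro ⟨j, q⟩ ⟨k, r⟩ ⟨k', r'⟩ ⟨w, hW, hA, -, τ, K, K', h1, h2, h3, h4⟩ ⟨w', -, -, -, τ', L, L', h1', h2', h3', h4'⟩
      dsimp only at *
      obtain ⟨e, rfl⟩ := hA.uniq hW h2 h2'
      obtain rfl : τ = τ' := by omega
      obtain ⟨rfl, e⟩ := Tr.func hW h1 h1'
      obtain ⟨-, rfl⟩ := Prod.mk.inj e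
      rw [h3] at h3'
      rw [Fin.ext h3']

theorem vert {W : List (Set (Fin n × Fin n))} {ρ q0} (hW : ∀ f ∈ W, IsDet f) {τ τ' K K' p p'} {q q' : Fin n} (h : Tr ρ W q0 τ K (p, q))
    (h' : Tr ρ W q0 τ' K' (p', q')) (hlt : τ < τ') (hp : p = 1 ∨ p = 2) (hp' : p' = 1 ∨ p' = 2) (a a' : ℤ)
    (ha : a = if p = 2 then (K p : ℤ) * n + q else -1 - ((K p : ℤ) * n + q))
    (ha' : a' = if p' = 2 then (K' p' : ℤ) * n + q' else -1 - ((K' p' : ℤ) * n + q')) :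
    (0 ≤ a → 0 ≤ a' → a < a') ∧ (a < 0 → a' < 0 → a' < a) := by
  have hm := (h'.mono hW τ K _ hlt h).2
  dsimp only at hm
  have hq := q.2
  have hq' := q'.2
  have hx : (0 : ℤ) ≤ (K p : ℤ) * n + q := by positivity
  have hx' : (0 : ℤ) ≤ (K' p' : ℤ) * n + q' := by positivity
  have key : p = p' → (K p : ℤ) * n + q < (K' p' : ℤ) * n + q' := by
    rintro rfl
    have h1 : ((K p : ℤ) + 1) * n ≤ (K' p : ℤ) * n := by
      apply mul_le_mul_of_nonneg_right <;> omega
    have : (q : ℤ) < n := by exact_mod_cast hq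
    nlinarith
  rcases hp with rfl | rfl <;> rcases hp' with rfl | rfl <;> simp at ha ha' key <;> constructor <;> intros <;> omega

/-- Rank in the final machine. -/
def Frk (s : Fin (n + 1) × Fin n) : ℤ := (s.1.1 : ℤ) * n + s.2.1

theorem Frk_inj : Function.Injective (Frk (n := n)) := by
  rintro ⟨a, b⟩ ⟨c, d⟩ h
  simp only [Frk] at h
  have hb := b.2
  have hd := d.2
  have h' : a.1 * n + b.1 = c.1 * n + d.1 := by exact_mod_cast h
  have e1 : a.1 = c.1 := by
    have := congrArg (· / n) h'
    have hn : 0 < n := by omega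
    simpa [Nat.mul_comm _ n, Nat.mul_add_div hn, Nat.div_eq_of_lt hb, Nat.div_eq_of_lt hd] using this
  have e2 : b.1 = d.1 := by
    rw [e1] at h'; omega
  rw [Fin.ext e1, Fin.ext e2]

theorem nocross {a b a' b' : ℤ} (h1 : (0 ≤ a → 0 ≤ a' → a < a') ∧ (a < 0 → a' < 0 → a' < a))
    (h2 : (0 ≤ a → 0 ≤ b' → a < b') ∧ (a < 0 → b' < 0 → b' < a))
    (h3 : (0 ≤ b → 0 ≤ a' → b < a') ∧ (b < 0 → a' < 0 → a' < b))
    (h4 : (0 ≤ b → 0 ≤ b' → b < b') ∧ (b < 0 → b' < 0 → b' < b)) :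
    ¬ (min a b < min a' b' ∧ min a' b' < max a b ∧ max a b < max a' b') ∧
    ¬ (min a' b' < min a b ∧ min a b < max a' b' ∧ max a' b' < max a b) := by
  constructor <;> omega

theorem FM_planar : (FM T).Planar := by
  refine ⟨_, rank_sto Frk Frk_inj, fun z => planar_of_rank Frk (fun q => by unfold Frk; positivity) ?_⟩
  rintro ⟨j, q⟩ ⟨k, r⟩ ⟨j', q'⟩ ⟨k', r'⟩ ⟨w, hW, hA, -, τ, K, K', h1, h2, h3, h4⟩ ⟨w', -, -, -, τ', L, L', h1', h2', h3', h4'⟩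
    a b a' b' ha hb ha' hb'
  dsimp only [FM, Frk] at *
  rw [← h3] at ha
  rw [← h4] at hb
  rw [← h3'] at ha'
  rw [← h4'] at hb'
  have hne : ∀ {τ K r q L}, Tr T.ρ (coarse T z) T.init τ K (1 + (if T.ρ r then 1 else 0), r) →
      Tr T.ρ (coarse T z) T.init τ L (1 + (if T.ρ q then 0 else 1), q) → False := by
    intro τ K r q L h h'
    obtain ⟨-, e⟩ := Tr.func hW h h'
    obtain ⟨e, rfl⟩ := Prod.mk.inj e
    cases hr : T.ρ r <;> simp [hr] at e
  have va : a = if 1 + (if T.ρ q then 0 else 1) = 2 then (K (1 + (if T.ρ q then 0 else 1)) : ℤ) * n + q else -1 - ((K (1 + (if T.ρ q then 0 else 1)) : ℤ) * n + q) := by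
    rw [ha]; by_cases hx : T.ρ q = true <;> simp [hx]
  have va' : a' = if 1 + (if T.ρ q' then 0 else 1) = 2 then (L (1 + (if T.ρ q' then 0 else 1)) : ℤ) * n + q' else -1 - ((L (1 + (if T.ρ q' then 0 else 1)) : ℤ) * n + q') := by
    rw [ha']; by_cases hx : T.ρ q' = true <;> simp [hx]
  have vb : b = if 1 + (if T.ρ r then 1 else 0) = 2 then (K' (1 + (if T.ρ r then 1 else 0)) : ℤ) * n + r else -1 - ((K' (1 + (if T.ρ r then 1 else 0)) : ℤ) * n + r) := by
    rw [hb]; by_cases hx : T.ρ r = true <;> simp [hx]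
  have vb' : b' = if 1 + (if T.ρ r' then 1 else 0) = 2 then (L' (1 + (if T.ρ r' then 1 else 0)) : ℤ) * n + r' else -1 - ((L' (1 + (if T.ρ r' then 1 else 0)) : ℤ) * n + r') := by
    rw [hb']; by_cases hx : T.ρ r' = true <;> simp [hx]
  have p1 : ∀ q, 1 + (if T.ρ q then 0 else 1) = 1 ∨ 1 + (if T.ρ q then 0 else 1) = 2 := by
    intro q; cases T.ρ q <;> simp
  have p2 : ∀ q, 1 + (if T.ρ q then 1 else 0) = 1 ∨ 1 + (if T.ρ q then 1 else 0) = 2 := by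
    intro q; cases T.ρ q <;> simp
  rcases lt_trichotomy τ τ' with hlt | rfl | hlt
  · have hlt' : τ + 1 < τ' := by
      rcases Nat.lt_or_eq_of_le (Nat.succ_le_of_lt hlt) with h | rfl
      · exact h
      · exact (hne h2 h1').elim
    exact (nocross (vert hW h1 h1' (by omega) (p1 q) (p1 q') _ _ va va') (vert hW h1 h2' (by omega) (p1 q) (p2 r') _ _ va vb')
      (vert hW h2 h1' (by omega) (p2 r) (p1 q') _ _ vb va') (vert hW h2 h2' (by omega) (p2 r) (p2 r') _ _ vb vb')).1
  · obtain ⟨rfl, e1⟩ := Tr.func hW h1 h1'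
    obtain ⟨rfl, e2⟩ := Tr.func hW h2 h2'
    obtain ⟨-, rfl⟩ := Prod.mk.inj e1
    obtain ⟨-, rfl⟩ := Prod.mk.inj e2
    rw [va, va', vb, vb']
    intro h
    exact lt_irrefl _ h.1
  · have hlt' : τ' + 1 < τ := by
      rcases Nat.lt_or_eq_of_le (Nat.succ_le_of_lt hlt) with h | rfl
      · exact h
      · exact (hne h2' h1).elim
    exact (nocross (vert hW h1' h1 (by omega) (p1 q') (p1 q) _ _ va' va) (vert hW h1' h2 (by omega) (p1 q') (p2 r) _ _ va' vb)
      (vert hW h2' h1 (by omega) (p2 r') (p1 q) _ _ vb' va) (vert hW h2' h2 (by omega) (p2 r') (p2 r) _ _ vb' vb)).2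

theorem tape_get_sym {Z : Type} (z : List Z) (i : ℕ) (a : Z) (h : z[i]? = some a) :
    (tapeOf z)[i + 1]? = some (Tape.sym a) := by
  obtain ⟨hi, h⟩ := List.getElem?_eq_some_iff.1 h
  simp [tapeOf, List.getElem?_append, hi, h]

theorem tape_cases {Z : Type} (z : List Z) (i : ℕ) (t : Tape Z) (h : (tapeOf z)[i]? = some t) :
    (i = 0 ∧ t = .lend) ∨ (i = z.length + 1 ∧ t = .rend) ∨ ∃ j a, i = j + 1 ∧ z[j]? = some a ∧ t = .sym a := by
  have hi := (List.getElem?_eq_some_iff.1 h).1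
  rw [tapeOf_length] at hi
  cases i with
  | zero => left; rw [tape_lend] at h; exact ⟨rfl, by simpa using h.symm⟩
  | succ j =>
    right
    by_cases hj : j < z.length
    · right
      have := tape_get_sym z j z[j] (by simp [hj])
      rw [this] at h
      exact ⟨j, z[j], rfl, by simp [hj], by simpa using h.symm⟩
    · left
      obtain rfl : j = z.length := by omega
      rw [tape_rend] at h
      exact ⟨rfl, by simpa using h.symm⟩

theorem FM_sound (u : List A) {c v} 
    (h : LRun (LSt (FM T).ρ (FM T).δ (tapeOf (bideco T u))) (0, (FM T).init) v c) :
    LRun (LSt T.ρ T.δ (tapeOf u)) (0, T.init) v (min (c.1 - 1) (tapeOf u).length, c.2.2) := by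
  generalize hd : (0, (FM T).init) = d at h
  induction h with
  | refl => subst hd; simpa [FM, Finit] using LRun.refl _
  | tail h1 h2 ih =>
    rename_i w b w' c
    obtain ⟨i, t, ht, hδ, e1, e2⟩ := h2
    rcases tape_cases _ _ _ ht with ⟨rfl, rfl⟩ | ⟨rfl, rfl⟩ | ⟨j, a, rfl, hj, rfl⟩
    · simp only [FM, Set.mem_singleton_iff, Prod.mk.injEq] at hδ
      obtain ⟨g1, rfl, g2⟩ := hδ
      have i0 := T.init_fwd
      simp only [FM, g1, g2, Finit, i0, if_true] at e1 e2
      simp only [e2, g2, e1, g1, Finit] at ih ⊢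
      simpa using ih
    · simp only [FM, Set.mem_setOf_eq] at hδ
      obtain ⟨g1, rfl, g2⟩ := hδ
      have g3 := g2
      rw [g1] at g3
      simp only [FM, g2, g3, if_true] at e1 e2
      rw [bideco_length] at e1 e2
      have e3 : min (b.1 - 1) (tapeOf u).length = min (c.1 - 1) (tapeOf u).length := by
        rw [e1, e2, tapeOf_length]; omega
      rw [e3, g1] at ih
      simpa using ih
    · have hl := (List.getElem?_eq_some_iff.1 hj).1
      rw [bideco_length, ← tapeOf_length] at hl
      have hget : (tapeOf u)[j]? = some (tapeOf u)[j] := by simp [hl]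
      have := bideco_get T u j _ hget
      rw [this] at hj
      have hj := Option.some.inj hj
      obtain ⟨-, -, hδ, -⟩ := hδ
      refine ih.tail ⟨j, (tapeOf u)[j], hget, ?_, ?_, ?_⟩
      · rw [← hj] at hδ; exact hδ
      · simp only [FM] at e1
        dsimp only
        rw [e1]; by_cases hx : T.ρ b.2.2 = true <;> simp only [hx, if_true, if_false, Bool.false_eq_true] <;> omega
      · simp only [FM] at e2
        dsimp only
        rw [e2]; by_cases hx : T.ρ c.2.2 = true <;> simp only [hx, if_true, if_false, Bool.false_eq_true] <;> omega

theorem LSt.toSt {W : List (Tape A)} {c c' w} (h : LSt T.ρ T.δ W c w c') : St T.ρ (W.map T.rel) c c' := by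
  obtain ⟨i, t, ht, hδ, e1, e2⟩ := h
  exact ⟨i, T.rel t, by simp [ht], ⟨w, hδ⟩, e1, e2⟩

theorem LRun.toTr {W : List (Tape A)} {c w} (h : LRun (LSt T.ρ T.δ W) (0, T.init) w c) :
    ∃ τ K, Tr T.ρ (W.map T.rel) T.init τ K c := by
  generalize hd : (0, T.init) = d at h
  induction h with
  | refl => subst hd; exact ⟨0, _, .zero⟩
  | tail h1 h2 ih =>
    obtain ⟨τ, K, h⟩ := ih
    exact ⟨_, _, .succ h (LSt.toSt T h2)⟩

theorem FM_complete (hdet : T.Deterministic) (u : List A) (hA : Acc T.ρ ((tapeOf u).map T.rel) T.init) {c v}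
    (h : LRun (LSt T.ρ T.δ (tapeOf u)) (0, T.init) v c) :
    ∃ (τ : ℕ) (K : ℕ → ℕ) (k : Fin (n + 1)), Tr T.ρ ((tapeOf u).map T.rel) T.init τ K c ∧ k.1 = K c.1 ∧
      LRun (LSt (FM T).ρ (FM T).δ (tapeOf (bideco T u))) (1, (FM T).init) v (c.1 + 1, (k, c.2)) := by
  have hW : ∀ (l : List (Tape A)), ∀ f ∈ l.map T.rel, IsDet f := by
    intro l f hf
    obtain ⟨t, -, rfl⟩ := List.mem_map.1 hf
    exact hdet t
  generalize hd : (0, T.init) = d at h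
  induction h with
  | refl =>
    subst hd
    exact ⟨0, _, (Finit T).1, .zero, by simp [Finit], .refl _⟩
  | tail h1 h2 ih =>
    rename_i w b w' c
    obtain ⟨τ, K, k, ht, hk, hrun⟩ := ih
    have hst := LSt.toSt T h2
    obtain ⟨b, q⟩ := b
    obtain ⟨b', r⟩ := c
    have ht' := Tr.succ ht hst
    have hb := hA.bound (hW _) ht' b'
    obtain ⟨i, t, hti, hδ, e1, e2⟩ := h2
    dsimp only at *
    rw [if_pos rfl, Nat.card_fin] at hb
    refine ⟨_, _, ⟨K b' + 1, Nat.lt_succ_of_le hb⟩, ht', (if_pos rfl).symm, hrun.tail ?_⟩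
    have hget := bideco_get T u i t hti
    refine ⟨i + 1, .sym _, tape_get_sym _ _ _ hget, ?_, ?_, ?_⟩
    rotate_left
    · show b + 1 = i + 1 + (if T.ρ q then 0 else 1); omega
    · show b' + 1 = i + 1 + (if T.ρ r then 1 else 0); omega
    · obtain ⟨hil, hi'⟩ := List.getElem?_eq_some_iff.1 hti
      have hco : coarse T ((t, ((tapeOf u).take i).foldl (stepP T) (idRel (Fin n))),
          ((tapeOf u).drop (i+1)).reverse.foldl (stepS T) (idRel (Fin n))) =
          [prof T.ρ (((tapeOf u).take i).map T.rel), T.rel t, prof T.ρ (((tapeOf u).drop (i+1)).map T.rel)] := by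
        unfold coarse
        rw [Xof_eq T u i t hti, Yof_eq T u i t hti]
      have hsp : (tapeOf u).map T.rel = ((tapeOf u).take i).map T.rel ++ T.rel t :: ((tapeOf u).drop (i+1)).map T.rel := by
        rw [← List.map_cons, ← List.map_append, ← hi', ← List.drop_eq_getElem_cons hil, List.take_append_drop]
      have hlen : (((tapeOf u).take i).map T.rel).length = i := by simp; omega
      rw [hsp] at ht hA
      have hA' := proj_acc _ _ _ T.init_fwd hA
      rw [e1] at ht
      obtain ⟨τ', K', hc, k1, k2⟩ := proj_in _ _ _ T.init_fwd (by rw [hlen]; exact ht)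
      rw [hlen] at k1 k2
      have hc' := Tr.succ (c' := (1 + (if T.ρ r then 1 else 0), r)) hc ⟨1, T.rel t, rfl, ⟨w', hδ⟩, rfl, rfl⟩
      show _ ∈ Fedge T _
      unfold Fedge
      rw [Set.mem_setOf_eq, hco]
      refine ⟨?_, hA', hδ, τ', K', _, hc, hc', ?_, ?_⟩
      · intro f hf
        simp only [List.mem_cons, List.not_mem_nil, or_false] at hf
        rcases hf with rfl | rfl | rfl
        · exact prof_det (hW _)
        · exact hdet t
        · exact prof_det (hW _)
      · dsimp only
        rw [hk, e1]
        cases T.ρ q <;> simp [k1, k2]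
      · dsimp only
        rw [if_pos rfl]
        have : K b' = K' (1 + if T.ρ r = true then 1 else 0) := by
          rw [e2]
          cases T.ρ r <;> simp [k1, k2]
        rw [← this]

theorem FM_realizes (hdet : T.Deterministic) (u : List A) (v : List B) :
    (FM T).Realizes (bideco T u) v ↔ T.Realizes u v := by
  rw [realizes_iff, realizes_iff]
  have hne : tapeOf u ≠ [] := by simp [tapeOf]
  constructor
  · rintro ⟨qf, hf, h⟩
    refine ⟨qf.2, hf, ?_⟩
    have := FM_sound T u h
    rw [tapeOf_length (bideco T u), bideco_length] at this
    have e : min (u.length + 2 + 2 - 1) (tapeOf u).length = (tapeOf u).length := by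
      rw [tapeOf_length]; omega
    dsimp only at this
    rwa [e] at this
  · rintro ⟨qf, hf, h⟩
    have hρ := final_fwd h hne
    have hA : Acc T.ρ ((tapeOf u).map T.rel) T.init := by
      obtain ⟨τ, K, ht⟩ := LRun.toTr T h
      exact ⟨τ, K, qf, by simpa using ht, hρ⟩
    obtain ⟨τ, K, k, -, -, hrun⟩ := FM_complete T hdet u hA h
    refine ⟨(k, qf), hf, ?_⟩
    have s1 : LSt (FM T).ρ (FM T).δ (tapeOf (bideco T u)) (0, (FM T).init) [] (1, (FM T).init) :=
      ⟨0, .lend, rfl, rfl, by simp [(FM T).init_fwd], by simp [(FM T).init_fwd]⟩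
    have s2 : LSt (FM T).ρ (FM T).δ (tapeOf (bideco T u)) ((tapeOf u).length + 1, (k, qf)) []
        ((tapeOf (bideco T u)).length, (k, qf)) := by
      refine ⟨(bideco T u).length + 1, .rend, tape_rend _, ⟨rfl, rfl, hρ⟩, ?_, ?_⟩
      · simp [FM, hρ, bideco_length, tapeOf_length]
      · simp [FM, hρ, tapeOf_length]
    have := ((LRun.single s1).trans hrun).tail s2
    simpa using this

end Final

/-- Renaming states. -/
def rename {Q Q' A B : Type} (e : Q ≃ Q') (T : TwoWayTransducer Q A B) : TwoWayTransducer Q' A B where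
  ρ q := T.ρ (e.symm q)
  init := e T.init
  init_fwd := by simpa using T.init_fwd
  final := {q | e.symm q ∈ T.final}
  δ a := {x | (e.symm x.1, x.2.1, e.symm x.2.2) ∈ T.δ a}

theorem rename_run {Q Q' A B : Type} (e : Q ≃ Q') (T : TwoWayTransducer Q A B) {W c v c'}
    (h : LRun (LSt T.ρ T.δ W) c v c') :
    LRun (LSt (rename e T).ρ (rename e T).δ W) (c.1, e c.2) v (c'.1, e c'.2) := by
  induction h with
  | refl => exact .refl _
  | tail h1 h2 ih =>
    obtain ⟨i, t, ht, hδ, e1, e2⟩ := h2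
    refine ih.tail ⟨i, t, ht, ?_, ?_, ?_⟩
    · simpa [rename] using hδ
    · simpa [rename] using e1
    · simpa [rename] using e2

theorem rename_run' {Q Q' A B : Type} (e : Q ≃ Q') (T : TwoWayTransducer Q A B) {W c v c'}
    (h : LRun (LSt (rename e T).ρ (rename e T).δ W) c v c') :
    LRun (LSt T.ρ T.δ W) (c.1, e.symm c.2) v (c'.1, e.symm c'.2) := by
  induction h with
  | refl => exact .refl _
  | tail h1 h2 ih =>
    obtain ⟨i, t, ht, hδ, e1, e2⟩ := h2
    exact ih.tail ⟨i, t, ht, hδ, e1, e2⟩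

theorem rename_realizes {Q Q' A B : Type} (e : Q ≃ Q') (T : TwoWayTransducer Q A B) (u v) :
    (rename e T).Realizes u v ↔ T.Realizes u v := by
  rw [realizes_iff, realizes_iff]
  constructor
  · rintro ⟨qf, hf, h⟩
    have := rename_run' e T h
    simp only [rename, Equiv.symm_apply_apply] at this
    exact ⟨_, hf, this⟩
  · rintro ⟨qf, hf, h⟩
    exact ⟨e qf, by simpa [rename] using hf, rename_run e T h⟩

theorem rename_rev {Q Q' A B : Type} (e : Q ≃ Q') (T : TwoWayTransducer Q A B) (h : T.Reversible) :
    (rename e T).Reversible := by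
  intro a
  constructor
  · rintro q r r' ⟨w, h1⟩ ⟨w', h2⟩
    exact e.symm.injective ((h a).1 _ _ _ ⟨w, h1⟩ ⟨w', h2⟩)
  · rintro q r r' ⟨w, h1⟩ ⟨w', h2⟩
    exact e.symm.injective ((h a).2 _ _ _ ⟨w, h1⟩ ⟨w', h2⟩)

theorem rename_planar {Q Q' A B : Type} (e : Q ≃ Q') (T : TwoWayTransducer Q A B) (h : T.Planar) :
    (rename e T).Planar := by
  obtain ⟨lt, hlt, hp⟩ := h
  refine ⟨fun x y => lt (e.symm x) (e.symm y), ?_, fun a => ?_⟩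
  · exact (RelIso.preimage e.symm lt).toRelEmbedding.isStrictTotalOrder
  · rintro ⟨u, r, v, s, h1, h2, h3, h4, h5⟩
    have hE : ∀ {x y}, ProfileEdge (rename e T).ρ ((rename e T).rel (.sym a)) x y →
        ProfileEdge T.ρ (T.rel (.sym a)) (e.symm x.1, x.2) (e.symm y.1, y.2) := by
      rintro x y ⟨⟨p, p'⟩, ⟨w, hm⟩, rfl, rfl⟩
      exact ⟨(e.symm p, e.symm p'), ⟨w, hm⟩, rfl, rfl⟩
    exact hp a ⟨(e.symm u.1, u.2), (e.symm r.1, r.2), (e.symm v.1, v.2), (e.symm s.1, s.2), h1, h2, h3,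
      h4.imp hE hE, h5.imp hE hE⟩

/-- every first-order transduction is computed by some planar
reversible two-way finite transducer. -/
theorem fo_transduction_planar_reversible {A B : Type} [Fintype A] [Fintype B]
    (f : List A → Option (List B)) (hf : IsFOTransduction f) :
    ∃ (n : ℕ) (T : TwoWayTransducer (Fin n) A B),
      T.Planar ∧ T.Reversible ∧ T.Computes f := by
  obtain ⟨n, T, hdet, hap, hc⟩ := hf
  obtain ⟨Q', hQ', T', hp, hr, hreal⟩ := good_bideco T hap B _ inferInstance (FM T) (FM_planar T) (FM_rev T)
  obtain ⟨m, ⟨e⟩⟩ := Finite.exists_equiv_fin Q'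
  refine ⟨m, rename e T', rename_planar e T' hp, rename_rev e T' hr, fun u v => ?_⟩
  rw [hc u v, rename_realizes, hreal, FM_realizes T hdet]

end Planar2DFT
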